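/- arXiv:2311.15013 — 9 statements merged into one kernel-verified Lean document; each statement's English description precedes it below -/
import Mathlib

section
/- Fix an integer h ≥ 1 and 0 ≤ θ < π/2. As z → 0 with z in the cone D_θ and q = e^{−z}, one has ã_h(q) ~ (α_h/z) · (−q;q)_∞ and b̃_h(q) ~ (β_h/z) · (−q;q)_∞, i.e. z·ã_h(e^{−z})/(−e^{−z};e^{−z})_∞ → α_h and z·b̃_h(e^{−z})/(−e^{−z};e^{−z})_∞ → β_h. -/
open Finset

/-- The number of parts of the partition `P` that are greater than `j`;
this is the length of column `j` (0-indexed) of the Ferrers diagram,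
i.e. the conjugate part `λ'_{j+1}`. -/
def colLen {n : ℕ} (P : Nat.Partition n) (j : ℕ) : ℕ :=
  (P.parts.filter (fun p => j < p)).card

/-- The length of row `i` (0-indexed) of the Ferrers diagram of `P`,
i.e. the `(i+1)`-st largest part `λ_{i+1}` (or `0` if there is none). -/
def rowLen {n : ℕ} (P : Nat.Partition n) (i : ℕ) : ℕ :=
  ((Finset.range (n + 1)).filter (fun j => i < colLen P j)).card

/-- The number of cells of the Ferrers diagram of `P` whose hook number
`(λ_i − j) + (λ'_j − i) + 1` (1-indexed) equals `h`. -/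
def hookCount {n : ℕ} (P : Nat.Partition n) (h : ℕ) : ℕ :=
  (((Finset.range (n + 1)) ×ˢ (Finset.range (n + 1))).filter
    (fun ij => ij.2 < rowLen P ij.1 ∧
      rowLen P ij.1 + colLen P ij.2 = h + ij.1 + ij.2 + 1)).card

/-- `a h n`: the total number of hooks of length `h` among partitions of `n` into odd parts. -/
def hookOdd (h n : ℕ) : ℕ := ∑ P ∈ Nat.Partition.odds n, hookCount P h

/-- `b h n`: the total number of hooks of length `h` among partitions of `n` into distinct parts. -/
def hookDistinct (h n : ℕ) : ℕ := ∑ P ∈ Nat.Partition.distincts n, hookCount P h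

/-- The finite q-Pochhammer symbol `(x;q)_n = ∏_{i=0}^{n−1} (1 − x qⁱ)`. -/
def qPoch (x q : ℂ) (n : ℕ) : ℂ := ∏ i ∈ Finset.range n, (1 - x * q ^ i)

/-- The infinite product `(−q;q)_∞ = ∏_{i=1}^∞ (1 + qⁱ)`. -/
noncomputable def negqInf (q : ℂ) : ℂ := ∏' i : ℕ, (1 + q ^ (i + 1))

/-- The Gaussian binomial coefficient `C(n,k)_q = (q;q)_n / ((q;q)_k (q;q)_{n−k})`. -/
noncomputable def qBinom (n k : ℕ) (q : ℂ) : ℂ := qPoch q q n / (qPoch q q k * qPoch q q (n - k))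

/-- The generating function `ã_h(q) = Σ_{n≥0} a_h(n) qⁿ`. -/
noncomputable def atilde (h : ℕ) (q : ℂ) : ℂ := ∑' n : ℕ, (hookOdd h n : ℂ) * q ^ n

/-- The generating function `b̃_h(q) = Σ_{n≥0} b_h(n) qⁿ`. -/
noncomputable def btilde (h : ℕ) (q : ℂ) : ℂ := ∑' n : ℕ, (hookDistinct h n : ℂ) * q ^ n
/-- `I_A(j,l) = ∫₀^∞ (1 − e^{−2x})^j e^{−lx} dx`. -/
noncomputable def IA (j l : ℕ) : ℝ :=
  ∫ x in Set.Ioi (0 : ℝ), (1 - Real.exp (-2 * x)) ^ j * Real.exp (-(l : ℝ) * x)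

/-- `I_B(j,k) = ∫₀^∞ e^{−jx}/(1 + e^{−x})^k dx`. -/
noncomputable def IB (j k : ℕ) : ℝ :=
  ∫ x in Set.Ioi (0 : ℝ), Real.exp (-(j : ℝ) * x) / (1 + Real.exp (-x)) ^ k

/-- `α_h = Σ_{j=0}^{⌈h/2⌉−1} C(h−j−1,j) I_A(j,2h−4j) + Σ_{j=0}^{⌊h/2⌋−1} C(h−j−2,j) I_A(j,2h−4j−2)`. -/
noncomputable def alphaC (h : ℕ) : ℝ :=
  ∑ j ∈ Finset.range ((h + 1) / 2), (Nat.choose (h - j - 1) j : ℝ) * IA j (2 * h - 4 * j) +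
  ∑ j ∈ Finset.range (h / 2), (Nat.choose (h - j - 2) j : ℝ) * IA j (2 * h - 4 * j - 2)

/-- `β_h = Σ_{j=0}^{⌈h/2⌉−1} C(h−j−1,j) I_B(j+1,h−j)`. -/
noncomputable def betaC (h : ℕ) : ℝ :=
  ∑ j ∈ Finset.range ((h + 1) / 2), (Nat.choose (h - j - 1) j : ℝ) * IB (j + 1) (h - j)
/-- The cone `D_θ = {r e^{iα} : r ≥ 0, |α| ≤ θ}` in the right half-plane. -/
def Dcone (θ : ℝ) : Set ℂ := {z : ℂ | |z.arg| ≤ θ}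

section

open Filter Topology

theorem cos_mul_norm_le_re_of_mem_Dcone {θ : ℝ} (hθ : θ < Real.pi / 2) {z : ℂ}
    (hz : z ∈ Dcone θ) : Real.cos θ * ‖z‖ ≤ z.re := by
  have h1 : Real.cos θ ≤ Real.cos z.arg := by
    rw [← Real.cos_abs z.arg]
    exact Real.cos_le_cos_of_nonneg_of_le_pi (abs_nonneg _) (by linarith [Real.pi_pos]) hz
  rw [← Complex.norm_mul_cos_arg z, mul_comm]
  exact mul_le_mul_of_nonneg_left h1 (norm_nonneg _)

theorem exists_le_norm_one_add_exp_neg {c : ℝ} (hc : 0 < c) :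
    ∃ δ > 0, ∀ x : ℂ, c * ‖x‖ ≤ x.re → δ ≤ ‖1 + Complex.exp (-x)‖ := by
  refine ⟨min 1 (1 - Real.exp (-(c * (Real.pi / 2)))), lt_min one_pos ?_, fun x hx => ?_⟩
  · have : Real.exp (-(c * (Real.pi / 2))) < 1 := by
      rw [Real.exp_lt_one_iff]
      have := Real.pi_pos
      have : 0 < c * (Real.pi / 2) := by positivity
      linarith
    linarith
  · by_cases him : |x.im| ≤ Real.pi / 2
    · refine (min_le_left _ _).trans (le_trans ?_ (Complex.re_le_norm _))
      have : 0 ≤ Real.cos x.im := Real.cos_nonneg_of_mem_Icc (abs_le.mp him)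
      simp only [Complex.add_re, Complex.one_re, Complex.exp_re, Complex.neg_re, Complex.neg_im,
        Real.cos_neg]
      have := mul_nonneg (Real.exp_nonneg (-x.re)) this
      linarith
    · push Not at him
      refine (min_le_right _ _).trans ?_
      have h1 : c * (Real.pi / 2) ≤ x.re :=
        (mul_le_mul_of_nonneg_left (him.le.trans (Complex.abs_im_le_norm x)) hc.le).trans hx
      have h2 : ‖Complex.exp (-x)‖ ≤ Real.exp (-(c * (Real.pi / 2))) := by
        rw [Complex.norm_exp, Complex.neg_re]
        exact Real.exp_le_exp.mpr (neg_le_neg h1)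
      have h3 := norm_sub_le (1 + Complex.exp (-x)) (Complex.exp (-x))
      simp only [add_sub_cancel_right, norm_one] at h3
      linarith

theorem norm_one_sub_exp_neg_le {c : ℝ} (hc : 0 < c) {x : ℂ} (hx : c * ‖x‖ ≤ x.re)
    (hx1 : ‖x‖ ≤ 1) :
    ‖1 - Complex.exp (-x)‖ ≤ 4 / c * (1 - ‖Complex.exp (-x)‖) := by
  have h1 : ‖1 - Complex.exp (-x)‖ ≤ 2 * ‖x‖ := by
    have := Complex.norm_exp_sub_one_le (x := -x) (by simpa using hx1)
    rwa [norm_neg, norm_sub_rev] at this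
  have h0 : 0 ≤ x.re := le_trans (by positivity) hx
  have hre : x.re ≤ 1 := (Complex.re_le_norm x).trans hx1
  have h2 : x.re / 2 ≤ 1 - ‖Complex.exp (-x)‖ := by
    rw [Complex.norm_exp, Complex.neg_re, Real.exp_neg]
    have h3 := Real.add_one_le_exp x.re
    have h4 : (Real.exp x.re)⁻¹ ≤ (x.re + 1)⁻¹ := inv_anti₀ (by linarith) h3
    have h5 : (x.re + 1)⁻¹ ≤ 1 - x.re / 2 := by
      rw [inv_le_iff_one_le_mul₀ (by linarith)]
      nlinarith
    linarith
  calc ‖1 - Complex.exp (-x)‖ ≤ 2 * ‖x‖ := h1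
    _ = 4 / c * (c * ‖x‖ / 2) := by field_simp; ring
    _ ≤ 4 / c * (x.re / 2) := by gcongr
    _ ≤ _ := by gcongr

theorem mem_ball_one_two {u : ℂ} (hu : ‖u‖ ≤ 1) (hu1 : u ≠ -1) : u ∈ Metric.ball (1 : ℂ) 2 := by
  rw [mem_ball_iff_norm]
  by_contra! h
  apply hu1
  have h2 : ‖u - 1‖ ^ 2 ≥ 4 := by nlinarith
  have h3 : ‖u‖ ^ 2 ≤ 1 := by nlinarith [norm_nonneg u]
  rw [← Complex.normSq_eq_norm_sq, Complex.normSq_apply] at h2 h3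
  simp only [Complex.sub_re, Complex.sub_im, Complex.one_re, Complex.one_im] at h2
  apply Complex.ext
  · simp only [Complex.neg_re, Complex.one_re]; nlinarith [mul_self_nonneg u.im]
  · simp only [Complex.neg_im, Complex.one_im]; nlinarith [mul_self_nonneg u.im]

set_option maxHeartbeats 1000000 in
/-- Along a cone, the geometrically sampled sum is a Riemann sum for the derivative `g` of `Φ`. -/
theorem tendsto_one_sub_mul_tsum {c : ℝ} (hc : 0 < c) {F : ℂ → ℂ → ℂ} {g Φ : ℂ → ℂ}
    (hF : ∀ u : ℂ, ‖u‖ ≤ 1 → u ≠ -1 →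
      Tendsto (fun p : ℂ × ℂ => F p.1 p.2) (𝓝 (0, u)) (𝓝 (g u)))
    (hΦ : ∀ u ∈ Metric.ball (1 : ℂ) 2, HasDerivAt Φ (g u) u) :
    Tendsto (fun z : ℂ => (1 - Complex.exp (-z)) *
        ∑' i : ℕ, Complex.exp (-z) ^ i * F z (Complex.exp (-z) ^ i))
      (𝓝[{z | c * ‖z‖ ≤ z.re} \ {0}] 0) (𝓝 (Φ 1 - Φ 0)) := by
  obtain ⟨δ, hδ, hδx⟩ := exists_le_norm_one_add_exp_neg hc
  have hexp : Tendsto (fun z : ℂ => Complex.exp (-z)) (𝓝 0) (𝓝 1) := by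
    have : Continuous (fun z : ℂ => Complex.exp (-z)) := by fun_prop
    simpa using this.tendsto 0
  let K : Set ℂ := Metric.closedBall 0 1 ∩ {u | δ ≤ ‖1 + u‖}
  have hK : IsCompact K :=
    (isCompact_closedBall _ _).inter_right (isClosed_le (by fun_prop) (by fun_prop))
  have hKm : ∀ u ∈ K, ‖u‖ ≤ 1 ∧ u ≠ -1 := by
    rintro u ⟨h1, h2⟩
    refine ⟨by simpa using h1, ?_⟩
    rintro rfl
    simp only [add_neg_cancel, norm_zero, Set.mem_ofPred_eq] at h2
    linarith
  have hstrict : ∀ u ∈ Metric.ball (1 : ℂ) 2, HasStrictDerivAt Φ (g u) u := by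
    intro u hu
    have hd : DifferentiableOn ℂ Φ (Metric.ball 1 2) :=
      fun v hv => (hΦ v hv).differentiableAt.differentiableWithinAt
    have ha : AnalyticAt ℂ Φ u := hd.analyticAt (Metric.isOpen_ball.mem_nhds hu)
    have := ha.hasStrictDerivAt
    rwa [(hΦ u hu).deriv] at this
  have hΦ0 : ContinuousAt Φ 0 := (hΦ 0 (by simp)).continuousAt
  rw [Metric.tendsto_nhds]
  intro ε hε
  obtain ⟨η, hη, hηε⟩ : ∃ η > 0, η * (4 / c) < ε :=
    ⟨ε * c / 8, by positivity, by field_simp; linarith⟩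
  have hloc : ∀ u ∈ K, ∀ᶠ p : ℂ × ℂ in 𝓝 (0, u),
      ‖Φ p.2 - Φ (p.2 * Complex.exp (-p.1)) - (1 - Complex.exp (-p.1)) * (p.2 * F p.1 p.2)‖ ≤
        η * (‖p.2‖ * ‖1 - Complex.exp (-p.1)‖) := by
    intro u hu
    obtain ⟨hu1, hu2⟩ := hKm u hu
    have h1 := (hstrict u (mem_ball_one_two hu1 hu2)).hasStrictFDerivAt.isLittleO.def
      (half_pos hη)
    have h2 : Tendsto (fun p : ℂ × ℂ => (p.2, p.2 * Complex.exp (-p.1))) (𝓝 (0, u))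
        (𝓝 (u, u)) := by
      have : Continuous (fun p : ℂ × ℂ => (p.2, p.2 * Complex.exp (-p.1))) := by fun_prop
      simpa using this.tendsto (0, u)
    have h3 := (Metric.tendsto_nhds.mp (hF u hu1 hu2)) (η / 2) (half_pos hη)
    filter_upwards [h2.eventually h1, h3] with p hp1 hp2
    rw [dist_eq_norm] at hp2
    simp only [ContinuousLinearMap.toSpanSingleton_apply, smul_eq_mul] at hp1
    set w := Complex.exp (-p.1)
    have e1 : p.2 - p.2 * w = p.2 * (1 - w) := by ring
    rw [e1, norm_mul] at hp1
    have e2 : Φ p.2 - Φ (p.2 * w) - (1 - w) * (p.2 * F p.1 p.2) =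
        (Φ p.2 - Φ (p.2 * w) - p.2 * (1 - w) * g u) - p.2 * (1 - w) * (F p.1 p.2 - g u) := by
      ring
    rw [e2]
    refine (norm_sub_le _ _).trans ?_
    rw [norm_mul (p.2 * (1 - w)), norm_mul p.2]
    have : ‖p.2‖ * ‖1 - w‖ * ‖F p.1 p.2 - g u‖ ≤ ‖p.2‖ * ‖1 - w‖ * (η / 2) := by gcongr
    linarith
  have hunif := hK.eventually_forall_of_forall_eventually
    (P := fun z u => ‖Φ u - Φ (u * Complex.exp (-z)) - (1 - Complex.exp (-z)) * (u * F z u)‖ ≤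
        η * (‖u‖ * ‖1 - Complex.exp (-z)‖)) hloc
  have hbdd : ∀ᶠ z : ℂ in 𝓝 0, ∀ᶠ u : ℂ in 𝓝 0, ‖F z u‖ ≤ ‖g 0‖ + 1 := by
    have h1 := (hF 0 (by simp) (by simp)).norm.eventually (eventually_le_nhds
      (show ‖g 0‖ < ‖g 0‖ + 1 by linarith))
    rw [nhds_prod_eq] at h1
    exact h1.curry
  have hnorm : ∀ᶠ z : ℂ in 𝓝 0, ‖z‖ ≤ 1 := by
    have := Metric.closedBall_mem_nhds (0 : ℂ) one_pos
    filter_upwards [this] with z hz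
    simpa using hz
  filter_upwards [nhdsWithin_le_nhds hunif, nhdsWithin_le_nhds hbdd, nhdsWithin_le_nhds hnorm,
    self_mem_nhdsWithin] with z hz1 hz2 hz3 hz4
  obtain ⟨hzc, hz0⟩ := hz4
  replace hzc : c * ‖z‖ ≤ z.re := hzc
  have hzpos : 0 < ‖z‖ := norm_pos_iff.mpr hz0
  have hre : 0 < z.re := lt_of_lt_of_le (by positivity) hzc
  set w := Complex.exp (-z) with hw
  have hw1 : ‖w‖ < 1 := by
    rw [hw, Complex.norm_exp, Complex.neg_re, Real.exp_lt_one_iff]; linarith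
  have hwK : ∀ i : ℕ, w ^ i ∈ K := by
    intro i
    refine ⟨?_, ?_⟩
    · simpa using pow_le_one₀ (norm_nonneg w) hw1.le
    · have : w ^ i = Complex.exp (-(i * z)) := by
        rw [hw, ← Complex.exp_nat_mul]; congr 1; ring
      rw [this]
      apply hδx
      rw [norm_mul, Complex.norm_natCast, ← Complex.ofReal_natCast, Complex.re_ofReal_mul]
      calc c * (i * ‖z‖) = i * (c * ‖z‖) := by ring
        _ ≤ _ := by gcongr
  have hpow : Tendsto (fun i : ℕ => w ^ i) atTop (𝓝 0) :=
    tendsto_pow_atTop_nhds_zero_of_norm_lt_one hw1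
  have hsum : Summable fun i : ℕ => w ^ i * F z (w ^ i) := by
    refine Summable.of_norm_bounded_eventually_nat (g := fun i => ‖w‖ ^ i * (‖g 0‖ + 1))
      ((summable_geometric_of_lt_one (norm_nonneg _) hw1).mul_right _) ?_
    filter_upwards [hpow.eventually hz2] with i hi
    rw [norm_mul, norm_pow]
    gcongr
  have hpart : ∀ N : ℕ, ‖(1 - w) * ∑ i ∈ range N, w ^ i * F z (w ^ i) - (Φ 1 - Φ (w ^ N))‖ ≤
      η * (4 / c) := by
    intro N
    have e1 : Φ 1 - Φ (w ^ N) = ∑ i ∈ range N, (Φ (w ^ i) - Φ (w ^ (i + 1))) := by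
      rw [sum_range_sub']; simp
    rw [e1, mul_sum, norm_sub_rev, ← sum_sub_distrib]
    have h1 : (1 - ‖w‖) > 0 := by linarith
    calc _ ≤ ∑ i ∈ range N, η * (‖w‖ ^ i * ‖1 - w‖) := by
          refine norm_sum_le_of_le _ fun i _ => ?_
          have := hz1 (w ^ i) (hwK i)
          rwa [← pow_succ, norm_pow] at this
      _ = η * ‖1 - w‖ * ∑ i ∈ range N, ‖w‖ ^ i := by
          rw [mul_sum]; exact sum_congr rfl fun i _ => by ring
      _ ≤ η * ‖1 - w‖ * (1 - ‖w‖)⁻¹ := by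
          gcongr
          rw [← tsum_geometric_of_lt_one (norm_nonneg _) hw1]
          exact (summable_geometric_of_lt_one (norm_nonneg _) hw1).sum_le_tsum _
            fun i _ => by positivity
      _ ≤ η * (4 / c * (1 - ‖w‖)) * (1 - ‖w‖)⁻¹ := by
          gcongr
          exact norm_one_sub_exp_neg_le hc hzc hz3
      _ = η * (4 / c) := by field_simp
  have hlim : Tendsto (fun N : ℕ => ‖(1 - w) * ∑ i ∈ range N, w ^ i * F z (w ^ i) -
      (Φ 1 - Φ (w ^ N))‖) atTop
      (𝓝 ‖(1 - w) * ∑' i : ℕ, w ^ i * F z (w ^ i) - (Φ 1 - Φ 0)‖) :=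
    ((hsum.hasSum.tendsto_sum_nat.const_mul _).sub
      ((hΦ0.tendsto.comp hpow).const_sub _)).norm
  rw [dist_eq_norm]
  exact (le_of_tendsto' hlim hpart).trans_lt hηε

theorem integral_exp_neg_mul_eq {g Φ : ℂ → ℂ}
    (hg : DifferentiableOn ℂ g (Metric.ball (1 : ℂ) 2))
    (hΦ : ∀ u ∈ Metric.ball (1 : ℂ) 2, HasDerivAt Φ (g u) u) :
    ∫ x in Set.Ioi (0 : ℝ), ((Real.exp (-x) : ℝ) : ℂ) * g (Real.exp (-x) : ℝ) = Φ 1 - Φ 0 := by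
  have hmem : ∀ x ∈ Set.Ici (0 : ℝ), ((Real.exp (-x) : ℝ) : ℂ) ∈ Metric.ball (1 : ℂ) 2 := by
    intro x hx
    refine mem_ball_one_two ?_ ?_
    · rw [Complex.norm_real, Real.norm_eq_abs, abs_of_pos (Real.exp_pos _), Real.exp_le_one_iff]
      simpa using hx
    · intro h
      have h1 := congrArg Complex.re h
      simp only [Complex.ofReal_re, Complex.neg_re, Complex.one_re] at h1
      linarith [Real.exp_pos (-x)]
  have hderiv : ∀ x ∈ Set.Ici (0 : ℝ), HasDerivAt (fun x : ℝ => -Φ (Real.exp (-x) : ℝ))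
      (((Real.exp (-x) : ℝ) : ℂ) * g (Real.exp (-x) : ℝ)) x := by
    intro x hx
    have h1 : HasDerivAt (fun x : ℝ => ((Real.exp (-x) : ℝ) : ℂ))
        ((-Real.exp (-x) : ℝ) : ℂ) x := by
      have : HasDerivAt (fun x : ℝ => Real.exp (-x)) (-Real.exp (-x)) x := by
        simpa using (hasDerivAt_neg x).exp
      exact this.ofReal_comp
    have h2 := ((hΦ _ (hmem x hx)).comp x h1).neg
    refine h2.congr_deriv ?_
    push_cast
    ring
  have hgc : ContinuousOn (fun x : ℝ => g (Real.exp (-x) : ℝ)) (Set.Ici 0) :=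
    hg.continuousOn.comp (by fun_prop) hmem
  obtain ⟨C, hC⟩ : ∃ C, ∀ x ∈ Set.Ici (0 : ℝ), ‖g (Real.exp (-x) : ℝ)‖ ≤ C := by
    have hcomp : IsCompact ((fun t : ℝ => (t : ℂ)) '' Set.Icc 0 1) :=
      isCompact_Icc.image (by fun_prop)
    have hsub : ((fun t : ℝ => (t : ℂ)) '' Set.Icc 0 1) ⊆ Metric.ball (1 : ℂ) 2 := by
      rintro _ ⟨t, ht, rfl⟩
      refine mem_ball_one_two ?_ ?_
      · rw [Complex.norm_real, Real.norm_eq_abs, abs_of_nonneg ht.1]; exact ht.2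
      · intro h
        have h1 := congrArg Complex.re h
        simp only [Complex.ofReal_re, Complex.neg_re, Complex.one_re] at h1
        linarith [ht.1]
    obtain ⟨C, hC⟩ := hcomp.exists_bound_of_continuousOn (hg.continuousOn.mono hsub)
    refine ⟨C, fun x hx => hC _ ⟨Real.exp (-x), ⟨(Real.exp_pos _).le, ?_⟩, rfl⟩⟩
    rw [Real.exp_le_one_iff]; simpa using hx
  have hint : MeasureTheory.IntegrableOn
      (fun x : ℝ => ((Real.exp (-x) : ℝ) : ℂ) * g (Real.exp (-x) : ℝ)) (Set.Ioi 0) := by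
    refine MeasureTheory.Integrable.mono' (g := fun x => Real.exp (-x) * C)
      ((integrableOn_exp_neg_Ioi 0).mul_const C) ?_ ?_
    · refine ContinuousOn.aestronglyMeasurable ?_ measurableSet_Ioi
      exact (by fun_prop : Continuous fun x : ℝ => ((Real.exp (-x) : ℝ) : ℂ)).continuousOn.mul
        (hgc.mono Set.Ioi_subset_Ici_self)
    · filter_upwards [MeasureTheory.ae_restrict_mem measurableSet_Ioi] with x hx
      rw [norm_mul, Complex.norm_real, Real.norm_eq_abs, abs_of_pos (Real.exp_pos _)]
      gcongr
      exact hC x (Set.Ioi_subset_Ici_self hx)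
  have hlim : Tendsto (fun x : ℝ => -Φ (Real.exp (-x) : ℝ)) atTop (𝓝 (-Φ 0)) := by
    have h0 : Tendsto (fun x : ℝ => ((Real.exp (-x) : ℝ) : ℂ)) atTop (𝓝 0) := by
      rw [← Complex.ofReal_zero]
      exact (Complex.continuous_ofReal.tendsto 0).comp Real.tendsto_exp_neg_atTop_nhds_zero
    exact ((hΦ 0 (by simp)).continuousAt.tendsto.comp h0).neg
  rw [MeasureTheory.integral_Ioi_of_hasDerivAt_of_tendsto' hderiv hint hlim]
  simp only [neg_zero, Real.exp_zero, Complex.ofReal_one]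
  ring

theorem tendsto_mul_tsum_exp_pow {θ : ℝ} (hθ0 : 0 ≤ θ) (hθ : θ < Real.pi / 2) {d : ℕ}
    (hd : 0 < d) {F : ℂ → ℂ → ℂ} {g : ℂ → ℂ}
    (hF : ∀ u : ℂ, ‖u‖ ≤ 1 → u ≠ -1 →
      Tendsto (fun p : ℂ × ℂ => F p.1 p.2) (𝓝 (0, u)) (𝓝 (g u)))
    (hg : DifferentiableOn ℂ g (Metric.ball (1 : ℂ) 2)) :
    Tendsto (fun z : ℂ => z * ∑' i : ℕ, (Complex.exp (-z) ^ d) ^ i *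
        F z ((Complex.exp (-z) ^ d) ^ i))
      (𝓝[Dcone θ \ {0}] 0) (𝓝 ((d : ℂ)⁻¹ *
        ∫ x in Set.Ioi (0 : ℝ), ((Real.exp (-x) : ℝ) : ℂ) * g (Real.exp (-x) : ℝ))) := by
  obtain ⟨Φ, hΦ⟩ := hg.isExactOn_ball
  rw [integral_exp_neg_mul_eq hg hΦ]
  have hc : 0 < Real.cos θ := Real.cos_pos_of_mem_Ioo ⟨by linarith, hθ⟩
  have hd0 : (d : ℂ) ≠ 0 := by exact_mod_cast hd.ne'
  have key := tendsto_one_sub_mul_tsum hc (F := fun z u => F ((d : ℂ)⁻¹ * z) u) (g := g)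
    (Φ := Φ) (fun u hu hu1 => by
      have h : Tendsto (fun p : ℂ × ℂ => ((d : ℂ)⁻¹ * p.1, p.2)) (𝓝 (0, u)) (𝓝 (0, u)) := by
        have : Continuous (fun p : ℂ × ℂ => ((d : ℂ)⁻¹ * p.1, p.2)) := by fun_prop
        simpa using this.tendsto (0, u)
      exact (hF u hu hu1).comp h) hΦ
  have hmap : Tendsto (fun z : ℂ => (d : ℂ) * z) (𝓝[Dcone θ \ {0}] 0)
      (𝓝[{z | Real.cos θ * ‖z‖ ≤ z.re} \ {0}] 0) := by
    refine tendsto_nhdsWithin_iff.mpr ⟨?_, ?_⟩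
    · have : Continuous (fun z : ℂ => (d : ℂ) * z) := by fun_prop
      simpa using (this.tendsto 0).mono_left nhdsWithin_le_nhds
    · filter_upwards [self_mem_nhdsWithin] with z hz
      refine ⟨?_, by simpa [hd0] using hz.2⟩
      have h1 := cos_mul_norm_le_re_of_mem_Dcone hθ hz.1
      simp only [Set.mem_ofPred_eq]
      rw [norm_mul, Complex.norm_natCast, ← Complex.ofReal_natCast, Complex.re_ofReal_mul]
      calc Real.cos θ * (d * ‖z‖) = d * (Real.cos θ * ‖z‖) := by ring
        _ ≤ _ := by gcongr
  have hratio : Tendsto (fun z : ℂ => z / (1 - Complex.exp (-(d * z))))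
      (𝓝[Dcone θ \ {0}] 0) (𝓝 (d : ℂ)⁻¹) := by
    have hder : HasDerivAt (fun z : ℂ => 1 - Complex.exp (-(d * z))) (d : ℂ) 0 := by
      have h1 : HasDerivAt (fun z : ℂ => -((d : ℂ) * z)) (-(d : ℂ)) 0 := by
        simpa using ((hasDerivAt_id (0 : ℂ)).const_mul (d : ℂ)).fun_neg
      simpa using h1.cexp.const_sub 1
    have h2 := (hasDerivAt_iff_tendsto_slope.mp hder).inv₀ hd0
    refine (h2.mono_left (nhdsWithin_mono _ fun z hz => hz.2)).congr fun z => ?_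
    simp [slope_def_field]
  have hre : ∀ᶠ z in 𝓝[Dcone θ \ {0}] (0 : ℂ), 1 - Complex.exp (-(d * z)) ≠ 0 := by
    filter_upwards [self_mem_nhdsWithin] with z hz
    have h1 := cos_mul_norm_le_re_of_mem_Dcone hθ hz.1
    have h2 : 0 < ‖z‖ := norm_pos_iff.mpr hz.2
    have h3 : 0 < z.re := lt_of_lt_of_le (by positivity) h1
    intro h
    have h4 : ‖Complex.exp (-(d * z))‖ = 1 := by rw [← sub_eq_zero.mp h]; simp
    rw [Complex.norm_exp, Real.exp_eq_one_iff, ← Complex.ofReal_natCast, Complex.neg_re,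
      Complex.re_ofReal_mul] at h4
    have : 0 < (d : ℝ) * z.re := by positivity
    linarith
  refine (hratio.mul (key.comp hmap)).congr' ?_
  filter_upwards [hre] with z hz
  have e : Complex.exp (-z) ^ d = Complex.exp (-(d * z)) := by
    rw [← Complex.exp_nat_mul]; congr 1; ring
  simp only [Function.comp_apply, e]
  rw [inv_mul_cancel_left₀ hd0, ← mul_assoc, div_mul_cancel₀ _ hz]

/-- The generating function `∑_{s ∈ A} q ^ |s|` of a set `A` of multisets of parts. -/
noncomputable def multisetGF (q : ℂ) (A : Set (Multiset ℕ)) : ℂ :=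
  ∑' s : Multiset ℕ, A.indicator (fun s => q ^ s.sum) s

/-- Multisets of distinct positive parts. -/
def distinctClass : Set (Multiset ℕ) := {s | s.Nodup ∧ 0 ∉ s}

/-- Multisets of odd parts. -/
def oddClass : Set (Multiset ℕ) := {s | ∀ x ∈ s, Odd x}

/-- Multisets of parts for which column `j` (0-indexed) contains a cell with arm length `a`
and leg length `l`. -/
def hookSet (j a l : ℕ) : Set (Multiset ℕ) :=
  {s | (s.filter (fun x => j < x ∧ x ≤ j + a)).card ≤ l ∧
    l < (s.filter (fun x => j < x ∧ x ≤ j + a + 1)).card}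

theorem partition_parts_injective :
    Function.Injective (fun p : (Σ n, Nat.Partition n) => p.2.parts) := by
  rintro ⟨n, P⟩ ⟨m, Q⟩ h
  have hnm : n = m := by rw [← P.parts_sum, ← Q.parts_sum]; exact congrArg _ h
  subst hnm
  congr 1
  exact Nat.Partition.ext h

theorem mem_range_partition_parts {s : Multiset ℕ} (hs : 0 ∉ s) :
    s ∈ Set.range (fun p : (Σ n, Nat.Partition n) => p.2.parts) :=
  ⟨⟨s.sum, ⟨s, fun {_} hi => Nat.pos_of_ne_zero fun h => hs (h ▸ hi), rfl⟩⟩, rfl⟩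

theorem summable_multiset_iff {f : Multiset ℕ → ℝ} (hf : ∀ s, 0 ≤ f s)
    (h0 : ∀ s, 0 ∈ s → f s = 0) :
    Summable f ↔ Summable (fun n => ∑ P : Nat.Partition n, f P.parts) := by
  rw [← partition_parts_injective.summable_iff (f := f)
    (fun s hs => h0 s (by_contra fun h => hs (mem_range_partition_parts h))),
    summable_sigma_of_nonneg (f := f ∘ fun p : (Σ n, Nat.Partition n) => p.2.parts)
      (fun p => hf _)]
  simp only [Function.comp_apply, tsum_fintype]
  exact and_iff_right fun n => (hasSum_fintype _).summable

theorem tsum_multiset_eq {f : Multiset ℕ → ℂ} (hf : Summable f) (h0 : ∀ s, 0 ∈ s → f s = 0) :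
    ∑' s, f s = ∑' n, ∑ P : Nat.Partition n, f P.parts := by
  have hsupp : ∀ s, s ∉ Set.range (fun p : (Σ n, Nat.Partition n) => p.2.parts) → f s = 0 :=
    fun s hs => h0 s (by_contra fun h => hs (mem_range_partition_parts h))
  rw [← partition_parts_injective.tsum_eq (Function.support_subset_iff'.mpr hsupp)]
  rw [Summable.tsum_sigma' (f := fun p : (Σ n, Nat.Partition n) => f p.2.parts)
    (fun n => (hasSum_fintype _).summable)
    ((partition_parts_injective.summable_iff hsupp).mpr hf)]
  simp only [tsum_fintype]

theorem hasSum_distinctClass {q : ℂ} (hq : ‖q‖ < 1) :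
    HasSum (distinctClass.indicator (fun s => q ^ s.sum)) (negqInf q) := by
  have hn : Summable fun i : ℕ => ‖q ^ (i + 1)‖ := by
    simp only [norm_pow]
    exact (summable_nat_add_iff 1).mpr (summable_geometric_of_lt_one (norm_nonneg _) hq)
  have hs := summable_finsetProd_of_summable_norm hn
  have hsum := hs.hasSum
  rw [← tprod_one_add hs] at hsum
  change HasSum _ (negqInf q) at hsum
  have hinj : Function.Injective (fun t : Finset ℕ => t.val.map (· + 1)) := fun t t' h =>
    Finset.val_injective (Multiset.map_injective (add_left_injective 1) h)
  rw [← hinj.hasSum_iff]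
  · convert hsum using 2 with t
    have : t.val.map (· + 1) ∈ distinctClass := by
      refine ⟨t.nodup.map (add_left_injective 1), ?_⟩
      simp
    simp only [Function.comp_apply]
    rw [Set.indicator_of_mem this, Finset.prod_pow_eq_pow_sum]
    rfl
  · intro s hs
    refine Set.indicator_of_notMem (fun h => hs ?_) _
    have hpred : (s.map (· - 1)).map (· + 1) = s := by
      rw [Multiset.map_map]
      conv_rhs => rw [← Multiset.map_id s]
      refine Multiset.map_congr rfl fun x hx => ?_
      have : x ≠ 0 := fun h0 => h.2 (h0 ▸ hx)
      simp only [Function.comp_apply, id]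
      omega
    refine ⟨⟨s.map (· - 1), Multiset.Nodup.of_map (· + 1) (by rw [hpred]; exact h.1)⟩, hpred⟩

theorem sum_partition_indicator {R : Type*} [AddCommMonoid R] {n : ℕ}
    {C : Set (Multiset ℕ)} {S : Finset (Nat.Partition n)} (hS : ∀ P, P ∈ S ↔ P.parts ∈ C)
    (f : Multiset ℕ → R) :
    ∑ P : Nat.Partition n, C.indicator f P.parts = ∑ P ∈ S, f P.parts := by
  classical
  rw [← Finset.sum_subset (Finset.subset_univ S)]
  · exact Finset.sum_congr rfl fun P hP => Set.indicator_of_mem ((hS P).mp hP) _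
  · exact fun P _ hP => Set.indicator_of_notMem (fun h => hP ((hS P).mpr h)) _

theorem mem_distincts_iff {n : ℕ} (P : Nat.Partition n) :
    P ∈ Nat.Partition.distincts n ↔ P.parts ∈ distinctClass := by
  simp only [Nat.Partition.distincts, Finset.mem_filter, Finset.mem_univ, true_and,
    distinctClass, Set.mem_ofPred_eq]
  exact (and_iff_left fun h => (P.parts_pos h).ne' rfl).symm

theorem mem_odds_iff {n : ℕ} (P : Nat.Partition n) :
    P ∈ Nat.Partition.odds n ↔ P.parts ∈ oddClass := by
  simp [Nat.Partition.odds, Nat.Partition.restricted, oddClass]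

theorem zero_notMem_of_mem_oddClass {s : Multiset ℕ} (hs : s ∈ oddClass) : 0 ∉ s :=
  fun h => by simpa using hs 0 h

theorem hasSum_oddClass {q : ℂ} (hq : ‖q‖ < 1) :
    HasSum (oddClass.indicator (fun s => q ^ s.sum)) (negqInf q) := by
  have hD := hasSum_distinctClass hq
  have hD0 : ∀ s : Multiset ℕ, 0 ∈ s → s ∉ distinctClass := fun s hs h => h.2 hs
  have hO0 : ∀ s : Multiset ℕ, 0 ∈ s → s ∉ oddClass :=
    fun s hs h => zero_notMem_of_mem_oddClass h hs
  have hcard : ∀ {R : Type} [CommSemiring R] (x : R) (n : ℕ),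
      ∑ P : Nat.Partition n, oddClass.indicator (fun s => x ^ s.sum) P.parts =
        ∑ P : Nat.Partition n, distinctClass.indicator (fun s => x ^ s.sum) P.parts := by
    intro R _ x n
    rw [sum_partition_indicator mem_odds_iff, sum_partition_indicator mem_distincts_iff]
    simp [Nat.Partition.parts_sum, Nat.Partition.card_odds_eq_card_distincts]
  have hnorm : ∀ (C : Set (Multiset ℕ)) s, ‖C.indicator (fun s => q ^ s.sum) s‖ =
      C.indicator (fun s => ‖q‖ ^ s.sum) s := by
    intro C s
    rw [norm_indicator_eq_indicator_norm]
    simp only [norm_pow]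
  have hsO : Summable (oddClass.indicator (fun s => q ^ s.sum)) := by
    have h1 := hD.summable.norm
    simp only [hnorm] at h1
    rw [summable_multiset_iff
      (fun s => Set.indicator_nonneg (fun s _ => by positivity) s)
      (fun s hs => Set.indicator_of_notMem (hD0 s hs) _)] at h1
    refine Summable.of_norm ?_
    simp only [hnorm]
    rw [summable_multiset_iff
      (fun s => Set.indicator_nonneg (fun s _ => by positivity) s)
      (fun s hs => Set.indicator_of_notMem (hO0 s hs) _)]
    simpa only [hcard] using h1
  have := hsO.hasSum
  rwa [tsum_multiset_eq hsO (fun s hs => Set.indicator_of_notMem (hO0 s hs) _),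
    funext (hcard q),
    ← tsum_multiset_eq hD.summable (fun s hs => Set.indicator_of_notMem (hD0 s hs) _),
    hD.tsum_eq] at this

theorem summable_indicator_subset {q : ℂ} {A B : Set (Multiset ℕ)} (hAB : A ⊆ B)
    (hB : Summable (B.indicator (fun s : Multiset ℕ => q ^ s.sum))) :
    Summable (A.indicator (fun s : Multiset ℕ => q ^ s.sum)) := by
  have := hB.indicator A
  rwa [Set.indicator_indicator, Set.inter_eq_left.mpr hAB] at this

/-- If every `s ∈ A` is uniquely `t i + r` with `i ∈ T` and `r ∈ B`, the generating function
of `A` factors. -/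
theorem multisetGF_eq_sum_mul {q : ℂ} {ι : Type*} {T : Finset ι} {t : ι → Multiset ℕ}
    {A B : Set (Multiset ℕ)} (hB : Summable (B.indicator (fun s : Multiset ℕ => q ^ s.sum)))
    (hmem : ∀ s, s ∈ A ↔ ∃ i ∈ T, ∃ r ∈ B, t i + r = s)
    (huniq : ∀ i ∈ T, ∀ i' ∈ T, ∀ r ∈ B, ∀ r' ∈ B, t i + r = t i' + r' → i = i') :
    multisetGF q A = (∑ i ∈ T, q ^ (t i).sum) * multisetGF q B := by
  classical
  have hone : ∀ i : ι, HasSum (((t i + ·) '' B).indicator (fun s : Multiset ℕ => q ^ s.sum))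
      (q ^ (t i).sum * multisetGF q B) := by
    intro i
    rw [← (add_right_injective (t i)).hasSum_iff]
    · refine (hB.hasSum.mul_left (q ^ (t i).sum)).congr_fun fun r => ?_
      by_cases hr : r ∈ B
      · simp [pow_add, hr]
      · simp [hr]
    · intro s hs
      refine Set.indicator_of_notMem (fun h => hs ?_) _
      obtain ⟨r, _, hr⟩ := h
      exact ⟨r, hr⟩
  have hall := hasSum_sum (s := T) fun i _ => hone i
  rw [← Finset.sum_mul] at hall
  rw [← hall.tsum_eq, multisetGF]
  refine tsum_congr fun s => ?_
  by_cases hs : s ∈ A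
  · obtain ⟨i, hi, r, hr, rfl⟩ := (hmem s).mp hs
    rw [Set.indicator_of_mem hs, Finset.sum_eq_single i]
    · have him : t i + r ∈ (t i + ·) '' B := ⟨r, hr, rfl⟩
      rw [Set.indicator_of_mem him]
    · rintro i' hi' hne
      refine Set.indicator_of_notMem ?_ _
      rintro ⟨r', hr', h⟩
      exact hne (huniq i' hi' i hi r' hr' r hr h)
    · exact fun h => absurd hi h
  · rw [Set.indicator_of_notMem hs, Finset.sum_eq_zero]
    intro i hi
    refine Set.indicator_of_notMem ?_ _
    rintro ⟨r, hr, rfl⟩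
    exact hs ((hmem _).mpr ⟨i, hi, r, hr, rfl⟩)

/-- Multisets none of whose elements lie in `W`. -/
def avoiding (W : Finset ℕ) : Set (Multiset ℕ) := {s | ∀ x ∈ W, x ∉ s}

theorem prod_mul_multisetGF_distinct {q : ℂ} (hq : ‖q‖ < 1) {W : Finset ℕ} (hW : 0 ∉ W) :
    (∏ i ∈ W, (1 + q ^ i)) * multisetGF q (distinctClass ∩ avoiding W) = negqInf q := by
  have hD := hasSum_distinctClass hq
  rw [← hD.tsum_eq, Finset.prod_one_add]
  change _ = multisetGF q distinctClass
  rw [multisetGF_eq_sum_mul (A := distinctClass) (B := distinctClass ∩ avoiding W)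
    (T := W.powerset) (t := fun T => T.val)
    (summable_indicator_subset Set.inter_subset_left hD.summable)]
  · congr 1
    refine Finset.sum_congr rfl fun T _ => ?_
    rw [Finset.prod_pow_eq_pow_sum, Finset.sum_val]
    rfl
  · intro s
    constructor
    · intro hs
      refine ⟨⟨s.filter (· ∈ W), hs.1.filter _⟩, ?_, s.filter (· ∉ W),
        ⟨⟨hs.1.filter _, fun h => hs.2 (Multiset.mem_of_mem_filter h)⟩, ?_⟩,
        Multiset.filter_add_not _ _⟩
      · rw [Finset.mem_powerset]
        intro x hx
        exact (Multiset.mem_filter.mp (Finset.mem_mk.mp hx)).2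
      · intro x hx h
        exact (Multiset.mem_filter.mp h).2 hx
    · rintro ⟨T, hT, r, ⟨hr, hrW⟩, rfl⟩
      rw [Finset.mem_powerset] at hT
      refine ⟨?_, ?_⟩
      · rw [Multiset.nodup_add]
        exact ⟨T.nodup, hr.1, Multiset.disjoint_left.mpr fun {x} hx hx' => hrW x (hT hx) hx'⟩
      · rw [Multiset.mem_add]
        rintro (h | h)
        · exact hW (hT h)
        · exact hr.2 h
  · have key : ∀ T ∈ W.powerset, ∀ r ∈ distinctClass ∩ avoiding W,
        (T.val + r).filter (· ∈ W) = T.val := by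
      intro T hT r hr
      rw [Finset.mem_powerset] at hT
      rw [Multiset.filter_add, Multiset.filter_eq_self.mpr fun x hx => hT hx,
        Multiset.filter_eq_nil.mpr fun x hx hxW => hr.2 x hxW hx, add_zero]
    intro T hT T' hT' r hr r' hr' h
    apply Finset.val_injective
    rw [← key T hT r hr, ← key T' hT' r' hr', h]

theorem multisetGF_odd_avoiding {q : ℂ} (hq : ‖q‖ < 1) {W : Finset ℕ} (hW : ∀ x ∈ W, Odd x) :
    multisetGF q (oddClass ∩ avoiding W) = (∏ i ∈ W, (1 - q ^ i)) * negqInf q := by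
  classical
  have hO := hasSum_oddClass hq
  have hsub : ∀ V, Summable ((oddClass ∩ avoiding V).indicator
      (fun s : Multiset ℕ => q ^ s.sum)) :=
    fun V => summable_indicator_subset Set.inter_subset_left hO.summable
  induction W using Finset.induction_on with
  | empty =>
    have : oddClass ∩ avoiding ∅ = oddClass := Set.inter_eq_left.mpr fun s _ => by simp [avoiding]
    rw [this, Finset.prod_empty, one_mul, ← hO.tsum_eq]
    rfl
  | insert i W hi ih =>
    specialize ih fun x hx => hW x (Finset.mem_insert_of_mem hx)
    have hiodd := hW i (Finset.mem_insert_self _ _)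
    rw [Finset.prod_insert hi, mul_assoc, ← ih, sub_mul, one_mul]
    have h1 : multisetGF q ((oddClass ∩ avoiding W) ∩ {s | i ∈ s}) =
        q ^ i * multisetGF q (oddClass ∩ avoiding W) := by
      rw [multisetGF_eq_sum_mul (T := {()}) (t := fun _ => {i}) (hsub W)]
      · simp
      · intro s
        constructor
        · rintro ⟨⟨hs, hsW⟩, his⟩
          refine ⟨(), by simp, s.erase i, ⟨fun x hx => hs x (Multiset.mem_of_mem_erase hx),
            fun x hx h => hsW x hx (Multiset.mem_of_mem_erase h)⟩, ?_⟩
          rw [Multiset.singleton_add, Multiset.cons_erase his]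
        · rintro ⟨_, _, r, ⟨hr, hrW⟩, rfl⟩
          refine ⟨⟨?_, ?_⟩, by simp⟩
          · intro x hx
            rcases Multiset.mem_add.mp hx with h | h
            · rwa [Multiset.mem_singleton.mp h]
            · exact hr x h
          · intro x hx h
            rcases Multiset.mem_add.mp h with h | h
            · rw [Multiset.mem_singleton.mp h] at hx
              exact hi hx
            · exact hrW x hx h
      · intros; rfl
    rw [← h1, eq_sub_iff_add_eq, multisetGF, multisetGF, multisetGF,
      ← (hsub _).tsum_add (summable_indicator_subset Set.inter_subset_left (hsub W))]
    refine tsum_congr fun s => ?_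
    by_cases hsC : s ∈ oddClass ∩ avoiding W
    · by_cases his : i ∈ s
      · have : s ∉ oddClass ∩ avoiding (insert i W) :=
          fun h => h.2 i (Finset.mem_insert_self _ _) his
        have h2 : s ∈ (oddClass ∩ avoiding W) ∩ {s | i ∈ s} := ⟨hsC, his⟩
        rw [Set.indicator_of_notMem this, Set.indicator_of_mem hsC, Set.indicator_of_mem h2,
          zero_add]
      · have : s ∈ oddClass ∩ avoiding (insert i W) := by
          refine ⟨hsC.1, fun x hx => ?_⟩
          rcases Finset.mem_insert.mp hx with rfl | h
          · exact his
          · exact hsC.2 x h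
        have h2 : s ∉ (oddClass ∩ avoiding W) ∩ {s | i ∈ s} := fun h => his h.2
        rw [Set.indicator_of_mem this, Set.indicator_of_mem hsC, Set.indicator_of_notMem h2,
          add_zero]
    · have : s ∉ oddClass ∩ avoiding (insert i W) :=
        fun h => hsC ⟨h.1, fun x hx => h.2 x (Finset.mem_insert_of_mem hx)⟩
      have h2 : s ∉ (oddClass ∩ avoiding W) ∩ {s | i ∈ s} := fun h => hsC h.1
      rw [Set.indicator_of_notMem this, Set.indicator_of_notMem hsC, Set.indicator_of_notMem h2,
        add_zero]

theorem filter_Ioc_succ (s : Multiset ℕ) (j a : ℕ) :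
    s.filter (fun x => j < x ∧ x ≤ j + a + 1) =
      s.filter (fun x => j < x ∧ x ≤ j + a) + Multiset.replicate (s.count (j + a + 1)) (j + a + 1)
      := by
  ext x
  rw [Multiset.count_add, Multiset.count_replicate, Multiset.count_filter, Multiset.count_filter]
  split_ifs <;> first | omega | (subst_vars; omega)

theorem multisetGF_distinct_hookSet {q : ℂ} (hq : ‖q‖ < 1) (j a l : ℕ) :
    multisetGF q (distinctClass ∩ hookSet j a l) =
      (∑ T ∈ (Ioc j (j + a)).powersetCard l, q ^ (j + a + 1 + ∑ x ∈ T, x)) *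
        multisetGF q (distinctClass ∩ avoiding (Ioc j (j + a + 1))) := by
  have hD := hasSum_distinctClass hq
  have hT : ∀ T ∈ (Ioc j (j + a)).powersetCard l, ∀ x ∈ T.val, j < x ∧ x ≤ j + a := by
    intro T hT x hx
    exact Finset.mem_Ioc.mp ((Finset.mem_powersetCard.mp hT).1 hx)
  have hr : ∀ r ∈ distinctClass ∩ avoiding (Ioc j (j + a + 1)), ∀ x ∈ r,
      ¬ (j < x ∧ x ≤ j + a + 1) :=
    fun r hr x hx h => hr.2 x (Finset.mem_Ioc.mpr h) hx
  have key : ∀ T ∈ (Ioc j (j + a)).powersetCard l,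
      ∀ r ∈ distinctClass ∩ avoiding (Ioc j (j + a + 1)),
      (((j + a + 1) ::ₘ T.val) + r).filter (fun x => j < x ∧ x ≤ j + a) = T.val := by
    intro T hT' r hr'
    rw [Multiset.filter_add, Multiset.filter_cons_of_neg _ (by omega),
      Multiset.filter_eq_self.mpr (hT T hT'),
      Multiset.filter_eq_nil.mpr fun x hx h => hr r hr' x hx (by omega), add_zero]
  rw [multisetGF_eq_sum_mul (T := (Ioc j (j + a)).powersetCard l)
    (t := fun T => (j + a + 1) ::ₘ T.val)
    (summable_indicator_subset Set.inter_subset_left hD.summable)]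
  · congr 1
    refine Finset.sum_congr rfl fun T _ => ?_
    rw [Multiset.sum_cons, Finset.sum_val]
    rfl
  · intro s
    constructor
    · rintro ⟨hs, h1, h2⟩
      have hsplit := filter_Ioc_succ s j a
      rw [hsplit, Multiset.card_add, Multiset.card_replicate] at h2
      have hcount := Multiset.nodup_iff_count_le_one.mp hs.1 (j + a + 1)
      have hc1 : s.count (j + a + 1) = 1 := by omega
      rw [hc1, Multiset.replicate_one] at hsplit
      refine ⟨⟨s.filter (fun x => j < x ∧ x ≤ j + a), hs.1.filter _⟩, ?_,
        s.filter (fun x => ¬ (j < x ∧ x ≤ j + a + 1)),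
        ⟨⟨hs.1.filter _, fun h => hs.2 (Multiset.mem_of_mem_filter h)⟩, ?_⟩, ?_⟩
      · rw [Finset.mem_powersetCard]
        refine ⟨fun x hx => ?_, ?_⟩
        · exact Finset.mem_Ioc.mpr (Multiset.mem_filter.mp (Finset.mem_mk.mp hx)).2
        · rw [Finset.card_mk]; omega
      · intro x hx h
        exact (Multiset.mem_filter.mp h).2 (Finset.mem_Ioc.mp hx)
      · change (j + a + 1) ::ₘ s.filter (fun x => j < x ∧ x ≤ j + a) + _ = s
        rw [← Multiset.singleton_add, add_comm {j + a + 1}, ← hsplit, Multiset.filter_add_not]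
    · rintro ⟨T, hT', r, hr', rfl⟩
      refine ⟨⟨?_, ?_⟩, ?_⟩
      · rw [Multiset.nodup_add, Multiset.nodup_cons]
        refine ⟨⟨fun h => ?_, T.nodup⟩, hr'.1.1, Multiset.disjoint_left.mpr fun {x} hx hx' => ?_⟩
        · have := hT T hT' _ h
          omega
        · refine hr r hr' x hx' ?_
          rcases Multiset.mem_cons.mp hx with rfl | h
          · omega
          · have := hT T hT' x h
            omega
      · rw [Multiset.mem_add, Multiset.mem_cons]
        rintro ((h | h) | h)
        · omega
        · have := hT T hT' _ h
          omega
        · exact hr'.1.2 h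
      · have hcard : T.val.card = l := (Finset.mem_powersetCard.mp hT').2
        refine ⟨?_, ?_⟩
        · rw [key T hT' r hr', hcard]
        · rw [filter_Ioc_succ, key T hT' r hr', Multiset.card_add, hcard, Multiset.card_replicate]
          have : 0 < ((j + a + 1) ::ₘ T.val + r).count (j + a + 1) :=
            Multiset.count_pos.mpr (by simp)
          omega
  · intro T hT T' hT' r hr r' hr' h
    apply Finset.val_injective
    rw [← key T hT r hr, ← key T' hT' r' hr', h]

theorem multisetGF_odd_hookSet_of_even {q : ℂ} {j a l : ℕ} (h : ¬ Odd (j + a + 1)) :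
    multisetGF q (oddClass ∩ hookSet j a l) = 0 := by
  have : oddClass ∩ hookSet j a l = ∅ := by
    refine Set.eq_empty_of_forall_notMem ?_
    rintro s ⟨hs, h1, h2⟩
    rw [filter_Ioc_succ, Multiset.count_eq_zero_of_notMem fun hm => h (hs _ hm)] at h2
    simp only [Multiset.replicate_zero, add_zero] at h2
    omega
  simp [multisetGF, this]

theorem multisetGF_odd_hookSet {q : ℂ} (hq : ‖q‖ < 1) {j a l k : ℕ} (hodd : Odd (j + a + 1))
    {f : Fin k → ℕ} (hf : Function.Injective f)
    (hrange : ∀ x, (∃ i, f i = x) ↔ Odd x ∧ j < x ∧ x ≤ j + a + 1) :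
    multisetGF q (oddClass ∩ hookSet j a l) =
      (∑ T : Sym (Fin k) l, q ^ (j + a + 1 + ((T : Multiset (Fin k)).map f).sum)) *
        multisetGF q (oddClass ∩ avoiding ((Ioc j (j + a)).filter Odd)) := by
  have hO := hasSum_oddClass hq
  have hT : ∀ T : Sym (Fin k) l, ∀ x ∈ (T : Multiset (Fin k)).map f,
      Odd x ∧ j < x ∧ x ≤ j + a + 1 := by
    intro T x hx
    obtain ⟨i, _, hi⟩ := Multiset.mem_map.mp hx
    exact (hrange x).mp ⟨i, hi⟩
  have hr : ∀ r ∈ oddClass ∩ avoiding ((Ioc j (j + a)).filter Odd), ∀ x ∈ r,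
      ¬ (j < x ∧ x ≤ j + a) :=
    fun r hr x hx h => hr.2 x (Finset.mem_filter.mpr ⟨Finset.mem_Ioc.mpr h, hr.1 x hx⟩) hx
  have key : ∀ T : Sym (Fin k) l, ∀ r ∈ oddClass ∩ avoiding ((Ioc j (j + a)).filter Odd),
      (((j + a + 1) ::ₘ (T : Multiset (Fin k)).map f) + r).filter
        (fun x => j < x ∧ x ≤ j + a) =
      ((T : Multiset (Fin k)).map f).filter (fun x => j < x ∧ x ≤ j + a) := by
    intro T r hr'
    rw [Multiset.filter_add, Multiset.filter_cons_of_neg _ (by omega),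
      Multiset.filter_eq_nil.mpr fun x hx h => hr r hr' x hx (by omega), add_zero]
  have hself : ∀ T : Sym (Fin k) l, (T : Multiset (Fin k)).map f =
      ((T : Multiset (Fin k)).map f).filter (fun x => j < x ∧ x ≤ j + a) +
        Multiset.replicate (((T : Multiset (Fin k)).map f).count (j + a + 1)) (j + a + 1) := by
    intro T
    rw [← filter_Ioc_succ, Multiset.filter_eq_self.mpr fun x hx => (hT T x hx).2]
  have hcard : ∀ T : Sym (Fin k) l,
      (((T : Multiset (Fin k)).map f).filter (fun x => j < x ∧ x ≤ j + a)).card +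
        ((T : Multiset (Fin k)).map f).count (j + a + 1) = l := by
    intro T
    have := congrArg Multiset.card (hself T)
    rw [Multiset.card_add, Multiset.card_replicate, Multiset.card_map] at this
    rw [← this]
    exact T.2
  rw [multisetGF_eq_sum_mul (T := Finset.univ)
    (t := fun T : Sym (Fin k) l => (j + a + 1) ::ₘ (T : Multiset (Fin k)).map f)
    (B := oddClass ∩ avoiding ((Ioc j (j + a)).filter Odd))
    (summable_indicator_subset Set.inter_subset_left hO.summable)]
  · simp only [Multiset.sum_cons]
  · intro s
    constructor
    · rintro ⟨hs, h1, h2⟩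
      have hsplit := filter_Ioc_succ s j a
      rw [hsplit, Multiset.card_add, Multiset.card_replicate] at h2
      set X := s.filter (fun x => j < x ∧ x ≤ j + a) with hX
      set m := j + a + 1 with hm
      obtain ⟨e, he⟩ : ∃ e, s.count m = (l - X.card) + 1 + e :=
        ⟨s.count m - ((l - X.card) + 1), by omega⟩
      set U := X + Multiset.replicate (l - X.card) m with hU
      have hUf : ∀ x ∈ U, ∃ i, f i = x := by
        intro x hx
        rw [hrange]
        rcases Multiset.mem_add.mp hx with h | h
        · obtain ⟨h3, h4⟩ := Multiset.mem_filter.mp h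
          exact ⟨hs x h3, h4.1, by omega⟩
        · rw [Multiset.eq_of_mem_replicate h]
          exact ⟨hodd, by omega, le_rfl⟩
      obtain ⟨V, hV⟩ : ∃ V : Multiset (Fin k), V.map f = U := by
        have : Nonempty (Fin k) := ⟨((hrange m).mpr ⟨hodd, by omega, le_rfl⟩).choose⟩
        choose! g hg using hUf
        refine ⟨U.map g, ?_⟩
        rw [Multiset.map_map]
        conv_rhs => rw [← Multiset.map_id U]
        exact Multiset.map_congr rfl fun x hx => hg x hx
      have hVc : V.card = l := by
        rw [← Multiset.card_map f, hV, hU, Multiset.card_add, Multiset.card_replicate]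
        omega
      refine ⟨⟨V, hVc⟩, Finset.mem_univ _, Multiset.replicate e m +
        s.filter (fun x => ¬ (j < x ∧ x ≤ m)), ⟨?_, ?_⟩, ?_⟩
      · intro x hx
        rcases Multiset.mem_add.mp hx with h | h
        · rw [Multiset.eq_of_mem_replicate h]
          exact hodd
        · exact hs x (Multiset.mem_of_mem_filter h)
      · intro x hx h
        have hx' := Finset.mem_Ioc.mp (Finset.mem_filter.mp hx).1
        rcases Multiset.mem_add.mp h with h | h
        · have := Multiset.eq_of_mem_replicate h
          omega
        · exact (Multiset.mem_filter.mp h).2 (by omega)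
      · change m ::ₘ V.map f + _ = s
        conv_rhs => rw [← Multiset.filter_add_not (fun x => j < x ∧ x ≤ m) s, hsplit, he]
        rw [hV, hU, Multiset.replicate_add, Multiset.replicate_add, Multiset.replicate_one,
          ← Multiset.singleton_add]
        abel
    · rintro ⟨T, _, r, hr', rfl⟩
      refine ⟨?_, ?_, ?_⟩
      · intro x hx
        rcases Multiset.mem_add.mp hx with h | h
        · rcases Multiset.mem_cons.mp h with rfl | h
          · exact hodd
          · exact (hT T x h).1
        · exact hr'.1 x h
      · have := hcard T
        rw [key T r hr']
        omega
      · have := hcard T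
        rw [filter_Ioc_succ, key T r hr', Multiset.card_add, Multiset.card_replicate,
          Multiset.count_add, Multiset.count_cons_self]
        omega
  · intro T _ T' _ r hr r' hr' h
    have h1 : ((T : Multiset (Fin k)).map f).filter (fun x => j < x ∧ x ≤ j + a) =
        ((T' : Multiset (Fin k)).map f).filter (fun x => j < x ∧ x ≤ j + a) := by
      rw [← key T r hr, ← key T' r' hr', h]
    have h2 := hcard T
    have h3 := hcard T'
    rw [h1] at h2
    apply Sym.coe_injective
    apply Multiset.map_injective hf
    rw [hself T, hself T', h1]
    congr 2
    omega

theorem colLen_antitone {n : ℕ} (P : Nat.Partition n) : Antitone (colLen P) := fun _ _ h =>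
  Multiset.card_le_card (Multiset.monotone_filter_right _ fun _ hx => lt_of_le_of_lt h hx)

theorem colLen_eq_zero {n : ℕ} (P : Nat.Partition n) {j : ℕ} (hj : n ≤ j) : colLen P j = 0 := by
  rw [colLen, Multiset.card_eq_zero, Multiset.filter_eq_nil]
  intro x hx
  have := P.le_of_mem_parts hx
  omega

theorem colLen_le {n : ℕ} (P : Nat.Partition n) (j : ℕ) : colLen P j ≤ n := by
  refine (Multiset.card_le_card (Multiset.filter_le _ _)).trans ?_
  have := Multiset.card_nsmul_le_sum (s := P.parts) (a := 1) fun x hx => P.parts_pos hx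
  simpa [P.parts_sum] using this

theorem lt_rowLen_iff {n : ℕ} (P : Nat.Partition n) (i j : ℕ) :
    j < rowLen P i ↔ i < colLen P j := by
  constructor
  · intro h
    by_contra hi
    have : rowLen P i ≤ (range j).card := by
      refine Finset.card_le_card fun x hx => ?_
      rw [Finset.mem_filter] at hx
      rw [Finset.mem_range]
      by_contra hxj
      have := colLen_antitone P (not_lt.mp hxj)
      omega
    rw [Finset.card_range] at this
    omega
  · intro h
    have hjn : j < n := by
      by_contra hj
      rw [colLen_eq_zero P (not_lt.mp hj)] at h
      omega
    have : (range (j + 1)).card ≤ rowLen P i := by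
      refine Finset.card_le_card fun x hx => ?_
      rw [Finset.mem_range] at hx
      rw [Finset.mem_filter, Finset.mem_range]
      have := colLen_antitone P (Nat.lt_succ_iff.mp hx)
      omega
    rw [Finset.card_range] at this
    omega

theorem colLen_eq_add {n : ℕ} (P : Nat.Partition n) (j a : ℕ) :
    colLen P j = (P.parts.filter (fun x => j < x ∧ x ≤ j + a)).card + colLen P (j + a) := by
  rw [colLen, colLen, ← Multiset.card_add,
    ← Multiset.filter_add_not (fun x => x ≤ j + a) (P.parts.filter (fun p => j < p)),
    Multiset.filter_filter, Multiset.filter_filter]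
  congr 2
  · exact Multiset.filter_congr fun x _ => and_comm
  · exact Multiset.filter_congr fun x _ => by omega

theorem mem_hookSet_parts_iff {n : ℕ} (P : Nat.Partition n) (j a l : ℕ) :
    P.parts ∈ hookSet j a l ↔
      colLen P j ≤ l + colLen P (j + a) ∧ l + colLen P (j + a + 1) < colLen P j := by
  have h1 := colLen_eq_add P j a
  have h2 := colLen_eq_add P j (a + 1)
  rw [← add_assoc] at h2
  rw [hookSet, Set.mem_ofPred_eq]
  omega

open Classical in
theorem hookCount_eq_sum {n : ℕ} (P : Nat.Partition n) (h : ℕ) :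
    hookCount P h = ∑ a ∈ range h,
      ((range (n + 1)).filter (fun j => P.parts ∈ hookSet j a (h - 1 - a))).card := by
  have : ∑ a ∈ range h,
      ((range (n + 1)).filter (fun j => P.parts ∈ hookSet j a (h - 1 - a))).card =
      ((range h ×ˢ range (n + 1)).filter
        (fun p => P.parts ∈ hookSet p.2 p.1 (h - 1 - p.1))).card := by
    simp only [Finset.card_filter, Finset.sum_product]
  rw [this, hookCount]
  refine Finset.card_nbij' (fun p => (rowLen P p.1 - p.2 - 1, p.2))
    (fun p => (colLen P p.2 - (h - p.1), p.2)) ?_ ?_ ?_ ?_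
  · rintro ⟨i, j⟩ hp
    simp only [Finset.coe_filter, Finset.mem_product, Finset.mem_range, Set.mem_ofPred_eq,
      mem_hookSet_parts_iff] at hp ⊢
    obtain ⟨⟨hi, hj⟩, h1, h2⟩ := hp
    have h3 := (lt_rowLen_iff P i j).mp h1
    have h4 := (lt_rowLen_iff P i (rowLen P i - 1)).mp (by omega)
    have h5 := (lt_rowLen_iff P i (rowLen P i)).not.mp (lt_irrefl _)
    have e1 : j + (rowLen P i - j - 1) = rowLen P i - 1 := by omega
    have e2 : rowLen P i - 1 + 1 = rowLen P i := by omega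
    rw [e1, e2]
    omega
  · rintro ⟨a, j⟩ hp
    simp only [Finset.coe_filter, Finset.mem_product, Finset.mem_range, Set.mem_ofPred_eq,
      mem_hookSet_parts_iff] at hp ⊢
    obtain ⟨⟨ha, hj⟩, h1, h2⟩ := hp
    have h3 := colLen_le P j
    have h4 := (lt_rowLen_iff P (colLen P j - (h - a)) (j + a)).mpr (by omega)
    have h5 := (lt_rowLen_iff P (colLen P j - (h - a)) (j + a + 1)).not.mpr (by omega)
    omega
  · rintro ⟨i, j⟩ hp
    simp only [Finset.coe_filter, Finset.mem_product, Finset.mem_range, Set.mem_ofPred_eq] at hp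
    obtain ⟨⟨hi, hj⟩, h1, h2⟩ := hp
    have h3 := (lt_rowLen_iff P i j).mp h1
    simp only [Prod.mk.injEq, and_true]
    omega
  · rintro ⟨a, j⟩ hp
    simp only [Finset.coe_filter, Finset.mem_product, Finset.mem_range, Set.mem_ofPred_eq,
      mem_hookSet_parts_iff] at hp
    obtain ⟨⟨ha, hj⟩, h1, h2⟩ := hp
    have h4 := (lt_rowLen_iff P (colLen P j - (h - a)) (j + a)).mpr (by omega)
    have h5 := (lt_rowLen_iff P (colLen P j - (h - a)) (j + a + 1)).not.mpr (by omega)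
    simp only [Prod.mk.injEq, and_true]
    omega

theorem lt_sum_of_mem_hookSet {s : Multiset ℕ} {j a l : ℕ} (h : s ∈ hookSet j a l) :
    j < s.sum := by
  obtain ⟨x, hx⟩ := Multiset.card_pos_iff_exists_mem.mp (lt_of_le_of_lt (Nat.zero_le l) h.2)
  obtain ⟨h1, h2⟩ := Multiset.mem_filter.mp hx
  exact h2.1.trans_le (Multiset.le_sum_of_mem h1)

theorem exists_natCast_add_one_mul_pow_le {x y : ℝ} (hx : 0 ≤ x) (hxy : x < y) :
    ∃ K, ∀ n : ℕ, ((n : ℝ) + 1) * x ^ n ≤ K * y ^ n := by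
  have hy : 0 < y := hx.trans_lt hxy
  have hr : Tendsto (fun n : ℕ => ((n : ℝ) + 1) * (x / y) ^ n) atTop (𝓝 0) := by
    have h0 : 0 ≤ x / y := by positivity
    have h1 : x / y < 1 := (div_lt_one hy).mpr hxy
    simpa [add_mul] using (tendsto_self_mul_const_pow_of_lt_one h0 h1).add
      (tendsto_pow_atTop_nhds_zero_of_lt_one h0 h1)
  obtain ⟨K, hK⟩ := hr.bddAbove_range
  refine ⟨K, fun n => ?_⟩
  have := hK ⟨n, rfl⟩
  simp only [div_pow] at this
  have hyn : 0 < y ^ n := by positivity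
  calc ((n : ℝ) + 1) * x ^ n = ((n : ℝ) + 1) * (x ^ n / y ^ n) * y ^ n := by field_simp
    _ ≤ K * y ^ n := by gcongr

open Classical in
theorem tsum_hookSet {C : Set (Multiset ℕ)}
    (hsum : ∀ y : ℂ, ‖y‖ < 1 → Summable (C.indicator (fun s : Multiset ℕ => y ^ s.sum)))
    {q : ℂ} (hq : ‖q‖ < 1) (a l : ℕ) :
    HasSum (C.indicator (fun s : Multiset ℕ =>
      (((range (s.sum + 1)).filter (fun j => s ∈ hookSet j a l)).card : ℂ) * q ^ s.sum))
      (∑' j, multisetGF q (C ∩ hookSet j a l)) := by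
  set φ : Multiset ℕ × ℕ → ℂ := fun p => (C ∩ hookSet p.2 a l).indicator
    (fun s => q ^ s.sum) p.1 with hφ
  have hrow : ∀ (s : Multiset ℕ) (j : ℕ), j ∉ range (s.sum + 1) → φ (s, j) = 0 := by
    intro s j hj
    refine Set.indicator_of_notMem (fun h => hj ?_) _
    have : j < s.sum := lt_sum_of_mem_hookSet h.2
    rw [Finset.mem_range]
    omega
  have hfin : ∀ s : Multiset ℕ, ∑ j ∈ range (s.sum + 1), φ (s, j) =
      C.indicator (fun s : Multiset ℕ =>
      (((range (s.sum + 1)).filter (fun j => s ∈ hookSet j a l)).card : ℂ) * q ^ s.sum) s := by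
    intro s
    by_cases hs : s ∈ C
    · rw [Set.indicator_of_mem hs, Finset.card_filter, Nat.cast_sum, Finset.sum_mul]
      refine Finset.sum_congr rfl fun j _ => ?_
      simp [hφ, Set.indicator_apply, hs]
    · rw [Set.indicator_of_notMem hs]
      refine Finset.sum_eq_zero fun j _ => ?_
      simp [hφ, Set.indicator_apply, hs]
  have hle : ∀ p : Multiset ℕ × ℕ, ‖φ p‖ ≤ C.indicator (fun s => ‖q‖ ^ s.sum) p.1 := by
    intro p
    refine (norm_indicator_eq_indicator_norm _ _).le.trans ?_
    simp only [norm_pow]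
    exact Set.indicator_le_indicator_of_subset Set.inter_subset_left
      (fun s => by positivity) p.1
  obtain ⟨y, hqy, hy1⟩ := exists_between hq
  have hy0 : 0 ≤ y := (norm_nonneg q).trans hqy.le
  obtain ⟨K, hK⟩ := exists_natCast_add_one_mul_pow_le (norm_nonneg q) hqy
  have hφs : Summable φ := by
    refine Summable.of_norm ?_
    rw [summable_prod_of_nonneg (fun p => norm_nonneg _)]
    refine ⟨fun s => summable_of_ne_finset_zero (s := range (s.sum + 1)) fun j hj => by
      rw [hrow s j hj, norm_zero], ?_⟩
    have hy := (hsum y (by rwa [Complex.norm_real, Real.norm_eq_abs, abs_of_nonneg hy0])).norm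
    refine Summable.of_nonneg_of_le (fun s => tsum_nonneg fun j => norm_nonneg _) (fun s => ?_)
      (hy.mul_left K)
    rw [tsum_eq_sum (s := range (s.sum + 1)) fun j hj => by rw [hrow s j hj, norm_zero]]
    refine (Finset.sum_le_sum fun j _ => hle (s, j)).trans ?_
    change ∑ _j ∈ range (s.sum + 1), C.indicator (fun s => ‖q‖ ^ s.sum) s ≤ _
    rw [Finset.sum_const, Finset.card_range, nsmul_eq_mul]
    by_cases hs : s ∈ C
    · rw [Set.indicator_of_mem hs, Set.indicator_of_mem hs, norm_pow, Complex.norm_real,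
        Real.norm_eq_abs, abs_of_nonneg hy0]
      rw [Nat.cast_add, Nat.cast_one]
      exact hK s.sum
    · simp [Set.indicator_of_notMem hs]
  have hS := hφs.prod
  have hT : ∀ s, ∑' j, φ (s, j) = C.indicator (fun s : Multiset ℕ =>
      (((range (s.sum + 1)).filter (fun j => s ∈ hookSet j a l)).card : ℂ) * q ^ s.sum) s :=
    fun s => by rw [← hfin s, tsum_eq_sum (hrow s)]
  simp only [hT] at hS
  have hcomm := Summable.tsum_comm' (f := fun s j => φ (s, j)) hφs
    (fun s => hφs.prod_factor s) (fun j => hφs.prod_symm.prod_factor j)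
  simp only [hT] at hcomm
  have := hS.hasSum
  rwa [← hcomm] at this

theorem tsum_hookCount_eq {C : Set (Multiset ℕ)} {S : ∀ n, Finset (Nat.Partition n)}
    (hS : ∀ n (P : Nat.Partition n), P ∈ S n ↔ P.parts ∈ C) (hC : ∀ s ∈ C, 0 ∉ s)
    (hsum : ∀ y : ℂ, ‖y‖ < 1 → Summable (C.indicator (fun s : Multiset ℕ => y ^ s.sum)))
    {q : ℂ} (hq : ‖q‖ < 1) (h : ℕ) :
    ∑' n, ((∑ P ∈ S n, hookCount P h : ℕ) : ℂ) * q ^ n =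
      ∑ a ∈ range h, ∑' j, multisetGF q (C ∩ hookSet j a (h - 1 - a)) := by
  classical
  have hH := hasSum_sum (s := range h) fun a _ => tsum_hookSet hsum hq a (h - 1 - a)
  rw [← hH.tsum_eq, tsum_multiset_eq hH.summable]
  · refine tsum_congr fun n => ?_
    rw [Finset.sum_comm]
    simp only [sum_partition_indicator (hS n)]
    rw [Finset.sum_comm, Nat.cast_sum, Finset.sum_mul]
    refine Finset.sum_congr rfl fun P _ => ?_
    rw [hookCount_eq_sum, Nat.cast_sum, Finset.sum_mul]
    refine Finset.sum_congr rfl fun a _ => ?_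
    rw [P.parts_sum]
  · intro s hs
    exact Finset.sum_eq_zero fun a _ => Set.indicator_of_notMem (fun hc => hC s hc hs) _

theorem negqInf_ne_zero {q : ℂ} (hq : ‖q‖ < 1) : negqInf q ≠ 0 := by
  refine tprod_one_add_ne_zero_of_summable (fun i hi => ?_) ?_
  · have h1 : q ^ (i + 1) = -1 := eq_neg_of_add_eq_zero_right hi
    have h2 : ‖q‖ ^ (i + 1) < 1 := pow_lt_one₀ (norm_nonneg q) hq i.succ_ne_zero
    rw [← norm_pow, h1] at h2
    simp at h2
  · simp only [norm_pow]
    exact (summable_nat_add_iff 1).mpr (summable_geometric_of_lt_one (norm_nonneg q) hq)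

/-- The generating function of partitions into distinct parts having a cell of arm length `a` and
leg length `l` in column `j`, divided by `(-q;q)_∞`, is `u * distinctKernel a l q u` at `u = q ^ j`. -/
noncomputable def distinctKernel (a l : ℕ) (q u : ℂ) : ℂ :=
  u ^ l * (∑ T ∈ (range a).powersetCard l, q ^ (a + 1 + l + ∑ x ∈ T, x)) /
    ∏ i ∈ range (a + 1), (1 + u * q ^ (i + 1))

theorem multisetGF_distinct_hookSet_eq_kernel {q : ℂ} (hq : ‖q‖ < 1) (j a l : ℕ) :
    multisetGF q (distinctClass ∩ hookSet j a l) =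
      negqInf q * (q ^ j * distinctKernel a l q (q ^ j)) := by
  have hne : ∏ i ∈ Ioc j (j + a + 1), (1 + q ^ i) ≠ 0 := fun h0 => negqInf_ne_zero hq (by
    rw [← prod_mul_multisetGF_distinct hq (W := Ioc j (j + a + 1)) (by simp), h0, zero_mul])
  have hprod : ∏ i ∈ Ioc j (j + a + 1), (1 + q ^ i) =
      ∏ i ∈ range (a + 1), (1 + q ^ j * q ^ (i + 1)) := by
    rw [← Finset.Ico_add_one_add_one_eq_Ioc, Finset.prod_Ico_eq_prod_range]
    refine Finset.prod_congr (by congr 1; omega) fun i _ => ?_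
    rw [← pow_add, add_assoc, add_comm 1 i]
  have hIoc : Ioc j (j + a) = (range a).map (addLeftEmbedding (j + 1)) := by
    ext x
    simp only [Finset.mem_Ioc, Finset.mem_map, Finset.mem_range, addLeftEmbedding_apply]
    exact ⟨fun h => ⟨x - (j + 1), by omega, by omega⟩, by rintro ⟨y, hy, rfl⟩; omega⟩
  have hsum : ∑ T ∈ (Ioc j (j + a)).powersetCard l, q ^ (j + a + 1 + ∑ x ∈ T, x) =
      q ^ j * ((q ^ j) ^ l * ∑ T ∈ (range a).powersetCard l, q ^ (a + 1 + l + ∑ x ∈ T, x)) := by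
    rw [hIoc, Finset.powersetCard_map, Finset.sum_map, Finset.mul_sum, Finset.mul_sum]
    refine Finset.sum_congr rfl fun T hT => ?_
    have hc : #T = l := (Finset.mem_powersetCard.mp hT).2
    change q ^ (j + a + 1 + ∑ x ∈ T.map (addLeftEmbedding (j + 1)), x) = _
    have hT : ∑ x ∈ T, addLeftEmbedding (j + 1) x = l * (j + 1) + ∑ x ∈ T, x := by
      simp only [addLeftEmbedding_apply]
      rw [Finset.sum_add_distrib, Finset.sum_const, hc, smul_eq_mul]
    rw [Finset.sum_map, hT, ← pow_mul, ← pow_add, ← pow_add]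
    congr 1
    ring
  have hGF := prod_mul_multisetGF_distinct hq (W := Ioc j (j + a + 1)) (by simp)
  rw [multisetGF_distinct_hookSet hq, hsum, ← hGF, distinctKernel, ← hprod]
  field_simp

theorem tendsto_distinctKernel (a l : ℕ) {u : ℂ} (hu : u ≠ -1) :
    Tendsto (fun p : ℂ × ℂ => distinctKernel a l (Complex.exp (-p.1)) p.2) (𝓝 (0, u))
      (𝓝 ((a.choose l : ℂ) * (u ^ l / (1 + u) ^ (a + 1)))) := by
  have hv : (a.choose l : ℂ) * (u ^ l / (1 + u) ^ (a + 1)) =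
      distinctKernel a l (Complex.exp (-((0 : ℂ), u).1)) ((0 : ℂ), u).2 := by
    simp [distinctKernel]
    ring
  rw [hv]
  refine ContinuousAt.tendsto (f := fun p : ℂ × ℂ => distinctKernel a l (Complex.exp (-p.1)) p.2) ?_
  unfold distinctKernel
  refine ContinuousAt.div (by fun_prop) (by fun_prop) ?_
  simpa [Finset.prod_const] using fun h : 1 + u = 0 => hu (eq_neg_of_add_eq_zero_right h)

theorem norm_exp_neg_lt_one {θ : ℝ} (hθ0 : 0 ≤ θ) (hθ : θ < Real.pi / 2) {z : ℂ}
    (hz : z ∈ Dcone θ \ {0}) : ‖Complex.exp (-z)‖ < 1 := by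
  have h1 := cos_mul_norm_le_re_of_mem_Dcone hθ hz.1
  have h2 : 0 < Real.cos θ := Real.cos_pos_of_mem_Ioo ⟨by linarith [Real.pi_pos], hθ⟩
  have h3 : 0 < ‖z‖ := norm_pos_iff.mpr hz.2
  rw [Complex.norm_exp, Real.exp_lt_one_iff, Complex.neg_re]
  nlinarith [mul_pos h2 h3]

theorem tendsto_distinct_hookSet {θ : ℝ} (hθ0 : 0 ≤ θ) (hθ : θ < Real.pi / 2) (a l : ℕ) :
    Tendsto (fun z : ℂ => z *
      (∑' j, multisetGF (Complex.exp (-z)) (distinctClass ∩ hookSet j a l)) /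
      negqInf (Complex.exp (-z))) (𝓝[Dcone θ \ {0}] 0)
      (𝓝 (((a.choose l : ℝ) * IB (l + 1) (a + 1) : ℝ) : ℂ)) := by
  have h := tendsto_mul_tsum_exp_pow hθ0 hθ one_pos
    (F := fun z u => distinctKernel a l (Complex.exp (-z)) u)
    (g := fun u => (a.choose l : ℂ) * (u ^ l / (1 + u) ^ (a + 1)))
    (fun u _ hu => tendsto_distinctKernel a l hu) (by
      refine DifferentiableOn.const_mul (DifferentiableOn.div (by fun_prop) (by fun_prop)
        fun u hu => pow_ne_zero _ fun h0 => ?_) _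
      rw [mem_ball_iff_norm, eq_neg_of_add_eq_zero_right h0] at hu
      norm_num at hu)
  have hI : ((1 : ℕ) : ℂ)⁻¹ * ∫ x in Set.Ioi (0 : ℝ), ((Real.exp (-x) : ℝ) : ℂ) *
      ((a.choose l : ℂ) * (((Real.exp (-x) : ℝ) : ℂ) ^ l /
        (1 + ((Real.exp (-x) : ℝ) : ℂ)) ^ (a + 1))) =
      (((a.choose l : ℝ) * IB (l + 1) (a + 1) : ℝ) : ℂ) := by
    rw [Nat.cast_one, inv_one, one_mul, IB, ← MeasureTheory.integral_const_mul,
      ← integral_complex_ofReal]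
    congr 1 with x
    have : Real.exp (-((l + 1 : ℕ) : ℝ) * x) = Real.exp (-x) ^ (l + 1) := by
      rw [← Real.exp_nat_mul]
      ring_nf
    rw [this]
    push_cast
    ring
  rw [hI] at h
  refine h.congr' ?_
  filter_upwards [self_mem_nhdsWithin] with z hz
  have hq := norm_exp_neg_lt_one hθ0 hθ hz
  simp only [multisetGF_distinct_hookSet_eq_kernel hq, pow_one]
  rw [tsum_mul_left]
  field_simp [negqInf_ne_zero hq]

/-- The generating function of partitions into odd parts having a cell of arm length `2 * k + p` and
leg length `l` in column `2 * i + p`, divided by `(-q;q)_∞`, is `u * oddKernel p k l q u`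
at `u = q ^ (2 * i)`. -/
noncomputable def oddKernel (p k l : ℕ) (q u : ℂ) : ℂ :=
  u ^ l * (∑ T : Sym (Fin (k + 1)) l,
    q ^ (2 * p + 2 * k + 1 + ((T : Multiset (Fin (k + 1))).map
      fun r : Fin (k + 1) => 2 * p + 1 + 2 * (r : ℕ)).sum)) *
    ∏ r ∈ range k, (1 - u * q ^ (2 * p + 1 + 2 * r))

theorem multisetGF_odd_hookSet_eq_kernel {q : ℂ} (hq : ‖q‖ < 1) (i k l : ℕ) {p : ℕ} (hp : p ≤ 1) :
    multisetGF q (oddClass ∩ hookSet (2 * i + p) (2 * k + p) l) =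
      negqInf q * ((q ^ 2) ^ i * oddKernel p k l q ((q ^ 2) ^ i)) := by
  rw [multisetGF_odd_hookSet hq (k := k + 1)
    (f := fun r => 2 * i + (2 * p + 1 + 2 * (r : ℕ))) ⟨i + p + k, by ring⟩
    (fun r s h => by ext; simpa using h),
    multisetGF_odd_avoiding hq fun x hx => (Finset.mem_filter.mp hx).2]
  · have himage : (Ioc (2 * i + p) (2 * i + p + (2 * k + p))).filter Odd =
        (range k).image (fun r => 2 * i + (2 * p + 1 + 2 * r)) := by
      ext x
      simp only [Finset.mem_filter, Finset.mem_Ioc, Finset.mem_image, Finset.mem_range]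
      constructor
      · rintro ⟨hx, y, rfl⟩
        exact ⟨y - i - p, by omega, by omega⟩
      · rintro ⟨r, hr, rfl⟩
        exact ⟨by omega, i + p + r, by ring⟩
    rw [himage, Finset.prod_image fun r _ s _ h => by simpa using h, oddKernel]
    have hsum : ∀ T : Sym (Fin (k + 1)) l,
        q ^ (2 * i + p + (2 * k + p) + 1 + ((T : Multiset (Fin (k + 1))).map
          fun r : Fin (k + 1) => 2 * i + (2 * p + 1 + 2 * (r : ℕ))).sum) =
        (q ^ 2) ^ i * ((q ^ 2) ^ i) ^ l * q ^ (2 * p + 2 * k + 1 +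
          ((T : Multiset (Fin (k + 1))).map
            fun r : Fin (k + 1) => 2 * p + 1 + 2 * (r : ℕ)).sum) := by
      intro T
      have hc : Multiset.card (T : Multiset (Fin (k + 1))) = l := T.2
      rw [Multiset.sum_map_add, Multiset.map_const', Multiset.sum_replicate, hc, smul_eq_mul]
      simp only [← pow_mul, ← pow_add]
      congr 1
      ring
    simp only [hsum, ← Finset.mul_sum, pow_add q (2 * i), pow_mul q 2]
    ring
  · intro x
    constructor
    · rintro ⟨r, rfl⟩
      exact ⟨⟨i + p + r, by ring⟩, by omega, by omega⟩
    · rintro ⟨⟨y, rfl⟩, h1, h2⟩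
      exact ⟨⟨y - i - p, by omega⟩, by simp only; omega⟩

theorem tsum_odd_hookSet {q : ℂ} (hq : ‖q‖ < 1) (k l : ℕ) {p : ℕ} (hp : p ≤ 1) :
    ∑' j, multisetGF q (oddClass ∩ hookSet j (2 * k + p) l) =
      negqInf q * ∑' i : ℕ, (q ^ 2) ^ i * oddKernel p k l q ((q ^ 2) ^ i) := by
  have hinj : Function.Injective fun i : ℕ => 2 * i + p := fun x y h => by simpa using h
  rw [← hinj.tsum_eq, ← tsum_mul_left]
  · exact tsum_congr fun i => multisetGF_odd_hookSet_eq_kernel hq i k l hp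
  · intro j hj
    have ho : Odd (j + (2 * k + p) + 1) := by
      by_contra ho
      exact hj (multisetGF_odd_hookSet_of_even ho)
    obtain ⟨y, hy⟩ := ho
    exact ⟨y - k - p, by simp only; omega⟩

theorem tendsto_oddKernel (p k l : ℕ) (u : ℂ) :
    Tendsto (fun x : ℂ × ℂ => oddKernel p k l (Complex.exp (-x.1)) x.2) (𝓝 (0, u))
      (𝓝 (((k + l).choose l : ℂ) * (u ^ l * (1 - u) ^ k))) := by
  have hv : ((k + l).choose l : ℂ) * (u ^ l * (1 - u) ^ k) =
      oddKernel p k l (Complex.exp (-((0 : ℂ), u).1)) ((0 : ℂ), u).2 := by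
    have hc : k + 1 + l - 1 = k + l := by omega
    simp [oddKernel, Sym.card_sym_eq_choose, hc]
    ring
  rw [hv]
  refine ContinuousAt.tendsto (f := fun x : ℂ × ℂ => oddKernel p k l (Complex.exp (-x.1)) x.2) ?_
  unfold oddKernel
  fun_prop

theorem tendsto_odd_hookSet {θ : ℝ} (hθ0 : 0 ≤ θ) (hθ : θ < Real.pi / 2) (k l : ℕ) {p : ℕ}
    (hp : p ≤ 1) :
    Tendsto (fun z : ℂ => z *
      (∑' j, multisetGF (Complex.exp (-z)) (oddClass ∩ hookSet j (2 * k + p) l)) /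
      negqInf (Complex.exp (-z))) (𝓝[Dcone θ \ {0}] 0)
      (𝓝 ((((k + l).choose l : ℝ) * IA k (2 * (l + 1)) : ℝ) : ℂ)) := by
  have h := tendsto_mul_tsum_exp_pow hθ0 hθ two_pos
    (F := fun z u => oddKernel p k l (Complex.exp (-z)) u)
    (g := fun u => ((k + l).choose l : ℂ) * (u ^ l * (1 - u) ^ k))
    (fun u _ _ => tendsto_oddKernel p k l u) (by fun_prop)
  have hI : ((2 : ℕ) : ℂ)⁻¹ * ∫ x in Set.Ioi (0 : ℝ), ((Real.exp (-x) : ℝ) : ℂ) *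
      (((k + l).choose l : ℂ) * (((Real.exp (-x) : ℝ) : ℂ) ^ l *
        (1 - ((Real.exp (-x) : ℝ) : ℂ)) ^ k)) =
      ((((k + l).choose l : ℝ) * IA k (2 * (l + 1)) : ℝ) : ℂ) := by
    have hs := MeasureTheory.integral_comp_mul_left_Ioi (fun x : ℝ => ((Real.exp (-x) : ℝ) : ℂ) *
      (((k + l).choose l : ℂ) * (((Real.exp (-x) : ℝ) : ℂ) ^ l *
        (1 - ((Real.exp (-x) : ℝ) : ℂ)) ^ k))) 0 two_pos
    rw [mul_zero, Complex.real_smul, Complex.ofReal_inv, Complex.ofReal_ofNat] at hs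
    rw [Nat.cast_ofNat, ← hs, IA, ← MeasureTheory.integral_const_mul, ← integral_complex_ofReal]
    congr 1 with x
    have : Real.exp (-((2 * (l + 1) : ℕ) : ℝ) * x) = Real.exp (-(2 * x)) ^ (l + 1) := by
      rw [← Real.exp_nat_mul]
      push_cast
      ring_nf
    rw [this, neg_mul]
    push_cast
    ring
  rw [hI] at h
  refine h.congr' ?_
  filter_upwards [self_mem_nhdsWithin] with z hz
  have hq := norm_exp_neg_lt_one hθ0 hθ hz
  rw [tsum_odd_hookSet hq k l hp]
  field_simp [negqInf_ne_zero hq]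

theorem sum_range_eq_sum_even_add_sum_odd {M : Type*} [AddCommMonoid M] (f : ℕ → M) (n : ℕ) :
    ∑ a ∈ range n, f a =
      ∑ k ∈ range ((n + 1) / 2), f (2 * k) + ∑ k ∈ range (n / 2), f (2 * k + 1) := by
  induction n with
  | zero => simp
  | succ n ih =>
    rw [Finset.sum_range_succ, ih]
    obtain ⟨m, rfl | rfl⟩ := Nat.even_or_odd' n
    · rw [show (2 * m + 1 + 1) / 2 = m + 1 by omega, show (2 * m + 1) / 2 = m by omega,
        show 2 * m / 2 = m by omega, Finset.sum_range_succ _ m]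
      abel
    · rw [show (2 * m + 1 + 1 + 1) / 2 = m + 1 by omega, show (2 * m + 1 + 1) / 2 = m + 1 by omega,
        show (2 * m + 1) / 2 = m by omega, Finset.sum_range_succ (fun k => f (2 * k + 1)) m]
      abel

theorem alphaC_eq (h : ℕ) : alphaC h = ∑ a ∈ range h,
    ((a / 2 + (h - 1 - a)).choose (h - 1 - a) : ℝ) * IA (a / 2) (2 * (h - 1 - a + 1)) := by
  rw [sum_range_eq_sum_even_add_sum_odd, alphaC]
  congr 1 <;> refine Finset.sum_congr rfl fun k hk => ?_ <;> rw [Finset.mem_range] at hk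
  · rw [show 2 * k / 2 = k by omega, show 2 * h - 4 * k = 2 * (h - 1 - 2 * k + 1) by omega,
      show k + (h - 1 - 2 * k) = h - k - 1 by omega, ← Nat.choose_symm (by omega : k ≤ h - k - 1),
      show h - k - 1 - k = h - 1 - 2 * k by omega]
  · rw [show (2 * k + 1) / 2 = k by omega,
      show 2 * h - 4 * k - 2 = 2 * (h - 1 - (2 * k + 1) + 1) by omega,
      show k + (h - 1 - (2 * k + 1)) = h - k - 2 by omega,
      ← Nat.choose_symm (by omega : k ≤ h - k - 2),
      show h - k - 2 - k = h - 1 - (2 * k + 1) by omega]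

theorem betaC_eq (h : ℕ) : betaC h = ∑ a ∈ range h,
    (a.choose (h - 1 - a) : ℝ) * IB (h - 1 - a + 1) (a + 1) := by
  rw [← Finset.sum_range_reflect, betaC]
  refine (Finset.sum_congr rfl fun j hj => ?_).trans
    (Finset.sum_subset (Finset.range_subset_range.mpr (by omega)) fun j hj hj' => ?_)
  · rw [Finset.mem_range] at hj
    rw [show h - 1 - (h - 1 - j) = j by omega, show h - 1 - j + 1 = h - j by omega,
      show h - 1 - j = h - j - 1 by omega]
  · rw [Finset.mem_range] at hj hj'
    rw [Nat.choose_eq_zero_of_lt (by omega), Nat.cast_zero, zero_mul]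

theorem tendsto_hookCount_gf {C : Set (Multiset ℕ)} {S : ∀ n, Finset (Nat.Partition n)}
    (hS : ∀ n (P : Nat.Partition n), P ∈ S n ↔ P.parts ∈ C) (hC : ∀ s ∈ C, 0 ∉ s)
    (hsum : ∀ y : ℂ, ‖y‖ < 1 → Summable (C.indicator (fun s : Multiset ℕ => y ^ s.sum)))
    {θ : ℝ} (hθ0 : 0 ≤ θ) (hθ : θ < Real.pi / 2) (h : ℕ) {c : ℕ → ℝ}
    (hc : ∀ a, Tendsto (fun z : ℂ => z *
      (∑' j, multisetGF (Complex.exp (-z)) (C ∩ hookSet j a (h - 1 - a))) /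
      negqInf (Complex.exp (-z))) (𝓝[Dcone θ \ {0}] 0) (𝓝 (c a : ℂ))) :
    Tendsto (fun z : ℂ => z * (∑' n, ((∑ P ∈ S n, hookCount P h : ℕ) : ℂ) * Complex.exp (-z) ^ n) /
      negqInf (Complex.exp (-z))) (𝓝[Dcone θ \ {0}] 0) (𝓝 ((∑ a ∈ range h, c a : ℝ) : ℂ)) := by
  rw [Complex.ofReal_sum]
  refine (tendsto_finsetSum (range h) fun a _ => hc a).congr' ?_
  filter_upwards [self_mem_nhdsWithin] with z hz
  rw [tsum_hookCount_eq hS hC hsum (norm_exp_neg_lt_one hθ0 hθ hz), Finset.mul_sum,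
    Finset.sum_div]

end

/-- As `z → 0` in the cone `D_θ` with `q = e^{−z}`, `ã_h(q) ~ (α_h/z)(−q;q)_∞` and
`b̃_h(q) ~ (β_h/z)(−q;q)_∞`, i.e. `z ã_h(e^{−z})/(−e^{−z};e^{−z})_∞ → α_h` and
`z b̃_h(e^{−z})/(−e^{−z};e^{−z})_∞ → β_h`. -/
theorem atilde_btilde_cone_asymptotic (h : ℕ) (hh : 1 ≤ h) (θ : ℝ) (hθ0 : 0 ≤ θ)
    (hθ : θ < Real.pi / 2) :
    Filter.Tendsto
      (fun z : ℂ => z * atilde h (Complex.exp (-z)) / negqInf (Complex.exp (-z)))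
      (nhdsWithin 0 (Dcone θ \ {0})) (nhds ((alphaC h : ℝ) : ℂ)) ∧
    Filter.Tendsto
      (fun z : ℂ => z * btilde h (Complex.exp (-z)) / negqInf (Complex.exp (-z)))
      (nhdsWithin 0 (Dcone θ \ {0})) (nhds ((betaC h : ℝ) : ℂ)) := by
  rw [alphaC_eq, betaC_eq]
  constructor
  · refine tendsto_hookCount_gf (fun _ P => mem_odds_iff P)
      (fun _ hs => zero_notMem_of_mem_oddClass hs) (fun y hy => (hasSum_oddClass hy).summable)
      hθ0 hθ h fun a => ?_
    have ha := tendsto_odd_hookSet hθ0 hθ (a / 2) (h - 1 - a) (Nat.le_of_lt_succ (a.mod_lt two_pos))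
    rwa [Nat.div_add_mod] at ha
  · exact tendsto_hookCount_gf (fun _ P => mem_distincts_iff P) (fun _ hs => hs.2)
      (fun y hy => (hasSum_distinctClass hy).summable) hθ0 hθ h fun a =>
      tendsto_distinct_hookSet hθ0 hθ a (h - 1 - a)
end

section
/- For every integer h ≥ 1, α_h = (α̃_h + α̃_{h−1})/2, where α̃_h := Σ_{j=0}^{⌊(h−1)/2⌋} Σ_{k=0}^{j} C(h−j−1, j) C(j, k) (−1)^k/(h−2j+k). -/
open Finset

/-- `α̃_h = Σ_{j=0}^{⌊(h−1)/2⌋} Σ_{k=0}^{j} C(h−j−1,j) C(j,k) (−1)^k/(h−2j+k)`. -/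
noncomputable def alphaTilde (h : ℕ) : ℝ :=
  ∑ j ∈ Finset.range ((h - 1) / 2 + 1), ∑ k ∈ Finset.range (j + 1),
    (Nat.choose (h - j - 1) j : ℝ) * (Nat.choose j k : ℝ) *
      (-1) ^ k / ((h : ℝ) - 2 * j + k)

open MeasureTheory in
theorem integrableOn_and_integral_exp_neg_mul {a : ℝ} (ha : 0 < a) :
    IntegrableOn (fun x : ℝ => Real.exp (-a * x)) (Set.Ioi 0) ∧
      ∫ x in Set.Ioi (0 : ℝ), Real.exp (-a * x) = 1 / a := by
  have ha' : -a < 0 := neg_lt_zero.mpr ha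
  refine ⟨integrableOn_exp_mul_Ioi ha' 0, ?_⟩
  rw [integral_exp_mul_Ioi ha' 0]
  simp

open MeasureTheory in
/-- Binomial expansion of `I_A`. -/
theorem IA_eq_sum (j : ℕ) {l : ℕ} (hl : 0 < l) :
    IA j l = ∑ k ∈ Finset.range (j + 1), (Nat.choose j k : ℝ) * (-1) ^ k / ((l : ℝ) + 2 * k) := by
  have hpos (k : ℕ) : (0 : ℝ) < (l : ℝ) + 2 * k := by positivity
  have expand (x : ℝ) : (1 - Real.exp (-2 * x)) ^ j * Real.exp (-(l : ℝ) * x) =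
      ∑ k ∈ Finset.range (j + 1),
        (Nat.choose j k : ℝ) * (-1) ^ k * Real.exp (-((l : ℝ) + 2 * k) * x) := by
    rw [sub_eq_neg_add, add_pow, Finset.sum_mul]
    refine Finset.sum_congr rfl fun k _ => ?_
    have hexp : Real.exp (-((l : ℝ) + 2 * k) * x) =
        Real.exp (-2 * x) ^ k * Real.exp (-(l : ℝ) * x) := by
      rw [← Real.exp_nat_mul, ← Real.exp_add]
      ring_nf
    rw [hexp, neg_pow (Real.exp (-2 * x))]
    ring
  simp_rw [IA, expand]
  rw [integral_finsetSum _ fun k _ =>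
    (integrableOn_and_integral_exp_neg_mul (hpos k)).1.const_mul _]
  refine Finset.sum_congr rfl fun k _ => ?_
  rw [integral_const_mul, (integrableOn_and_integral_exp_neg_mul (hpos k)).2]
  ring

theorem sum_choose_mul_IA_eq_alphaTilde_div_two (n : ℕ) :
    ∑ j ∈ Finset.range ((n + 1) / 2), (Nat.choose (n - j - 1) j : ℝ) * IA j (2 * n - 4 * j) =
      alphaTilde n / 2 := by
  rcases Nat.eq_zero_or_pos n with rfl | hn
  · simp [alphaTilde]
  rw [alphaTilde, show (n - 1) / 2 + 1 = (n + 1) / 2 by omega, Finset.sum_div]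
  refine Finset.sum_congr rfl fun j hj => ?_
  have hj' : 2 * j < n := by
    have := Finset.mem_range.mp hj
    omega
  rw [IA_eq_sum j (by omega), Finset.mul_sum, Finset.sum_div]
  refine Finset.sum_congr rfl fun k _ => ?_
  have hcast : ((2 * n - 4 * j : ℕ) : ℝ) + 2 * k = ((n : ℝ) - 2 * j + k) * 2 := by
    rw [Nat.cast_sub (by omega)]
    push_cast
    ring
  rw [hcast, div_div, mul_div_assoc', mul_assoc]

/-- For every `h ≥ 1`, `α_h = (α̃_h + α̃_{h−1})/2`. -/
theorem alphaC_eq_alphaTilde (h : ℕ) (hh : 1 ≤ h) :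
    alphaC h = (alphaTilde h + alphaTilde (h - 1)) / 2 := by
  rw [alphaC, sum_choose_mul_IA_eq_alphaTilde_div_two, add_div,
    ← sum_choose_mul_IA_eq_alphaTilde_div_two (h - 1), Nat.sub_add_cancel hh]
  congr 1
  refine Finset.sum_congr rfl fun j _ => ?_
  rw [show h - j - 2 = h - 1 - j - 1 by omega,
    show 2 * h - 4 * j - 2 = 2 * (h - 1) - 4 * j by omega]
end

section
/- Let h ≥ 1 be an integer. If h is even, then β_h = Σ_{j=0}^{(h−2)/2} C(h−j−1, j) Σ_{k=0}^{j} C(j, k) ((−1)^k/(h−2j+k−1)) (1 − 1/2^{h−2j+k−1}). If h is odd, then β_h = log 2 + Σ_{j=0}^{(h−1)/2} C(h−j−1, j) Σ_{k=1}^{j} C(j, k) ((−1)^k/(h−2j+k−1)) (1 − 1/2^{h−2j+k−1}) + Σ_{j=0}^{(h−3)/2} C(h−j−1, j) (1/(h−2j−1)) (1 − 1/2^{h−2j−1}). -/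
open Finset

open MeasureTheory Filter Topology

private lemma hasDerivAt_one_add_exp_neg (x : ℝ) :
    HasDerivAt (fun x : ℝ => 1 + Real.exp (-x)) (-Real.exp (-x)) x := by
  simpa using ((hasDerivAt_neg x).exp).const_add 1

private lemma tendsto_one_add_exp_neg :
    Tendsto (fun x : ℝ => 1 + Real.exp (-x)) atTop (𝓝 1) := by
  simpa using Real.tendsto_exp_neg_atTop_nhds_zero.const_add 1

private lemma hasDerivAt_neg_log_one_add_exp_neg (x : ℝ) :
    HasDerivAt (fun x : ℝ => -Real.log (1 + Real.exp (-x)))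
      (Real.exp (-x) / (1 + Real.exp (-x)) ^ 1) x := by
  have hpos : 0 < 1 + Real.exp (-x) := by positivity
  have hd := ((hasDerivAt_one_add_exp_neg x).log hpos.ne').neg
  rw [neg_div, neg_neg] at hd
  rwa [pow_one]

private lemma hasDerivAt_inv_pow_one_add_exp_neg (n : ℕ) (x : ℝ) :
    HasDerivAt (fun x : ℝ => ((n : ℝ) + 1)⁻¹ * ((1 + Real.exp (-x)) ^ (n + 1))⁻¹)
      (Real.exp (-x) / (1 + Real.exp (-x)) ^ (n + 2)) x := by
  have hpos : 0 < 1 + Real.exp (-x) := by positivity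
  have hn : (n : ℝ) + 1 ≠ 0 := by positivity
  refine ((((hasDerivAt_one_add_exp_neg x).fun_pow (n + 1)).fun_inv
    (pow_pos hpos _).ne').const_mul ((n : ℝ) + 1)⁻¹).congr_deriv ?_
  rw [Nat.add_sub_cancel]
  push_cast
  field_simp
  ring

private lemma integrableOn_exp_neg_div_one_add_exp_neg_pow (n : ℕ) :
    IntegrableOn (fun x : ℝ => Real.exp (-x) / (1 + Real.exp (-x)) ^ n) (Set.Ioi 0) := by
  refine (integrableOn_exp_neg_Ioi 0).mono'
    (Measurable.aestronglyMeasurable (by fun_prop)) ?_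
  refine Eventually.of_forall fun x => ?_
  rw [Real.norm_of_nonneg (by positivity)]
  exact div_le_self (by positivity) (one_le_pow₀ (by linarith [Real.exp_pos (-x)]))

private lemma integral_exp_neg_div_one_add_exp_neg :
    ∫ x in Set.Ioi (0 : ℝ), Real.exp (-x) / (1 + Real.exp (-x)) ^ 1 = Real.log 2 := by
  have hlim : Tendsto (fun x : ℝ => -Real.log (1 + Real.exp (-x))) atTop (𝓝 0) := by
    simpa using (tendsto_one_add_exp_neg.log one_ne_zero).neg
  rw [integral_Ioi_of_hasDerivAt_of_nonneg' (fun x _ => hasDerivAt_neg_log_one_add_exp_neg x)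
    (fun x _ => by positivity) hlim]
  norm_num

private lemma integral_exp_neg_div_one_add_exp_neg_pow (n : ℕ) :
    ∫ x in Set.Ioi (0 : ℝ), Real.exp (-x) / (1 + Real.exp (-x)) ^ (n + 2) =
      1 / ((n : ℝ) + 1) * (1 - 1 / 2 ^ (n + 1)) := by
  have hlim : Tendsto (fun x : ℝ => ((n : ℝ) + 1)⁻¹ * ((1 + Real.exp (-x)) ^ (n + 1))⁻¹) atTop
      (𝓝 ((n : ℝ) + 1)⁻¹) := by
    simpa using ((tendsto_one_add_exp_neg.pow (n + 1)).inv₀ (by simp)).const_mul ((n : ℝ) + 1)⁻¹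
  rw [integral_Ioi_of_hasDerivAt_of_nonneg' (fun x _ => hasDerivAt_inv_pow_one_add_exp_neg n x)
    (fun x _ => by positivity) hlim]
  norm_num
  ring

private lemma IB_eq_sum (j m : ℕ) :
    IB (j + 1) (j + m) = ∑ k ∈ range (j + 1), (Nat.choose j k : ℝ) * (-1) ^ k *
      ∫ x in Set.Ioi (0 : ℝ), Real.exp (-x) / (1 + Real.exp (-x)) ^ (m + k) := by
  simp_rw [IB, ← integral_const_mul]
  rw [← integral_finsetSum _ fun k _ =>
    (integrableOn_exp_neg_div_one_add_exp_neg_pow (m + k)).const_mul _]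
  refine integral_congr_ae (Eventually.of_forall fun x => ?_)
  have hpos : 0 < 1 + Real.exp (-x) := by positivity
  have hexp : Real.exp (-((j + 1 : ℕ) : ℝ) * x) =
      Real.exp (-x) * (-1 + (1 + Real.exp (-x))) ^ j := by
    rw [neg_add_cancel_left, ← pow_succ', ← Real.exp_nat_mul]
    ring_nf
  simp only [hexp]
  rw [add_pow, mul_sum, sum_div]
  refine sum_congr rfl fun k hk => ?_
  have hkj : j + m = (j - k) + (m + k) := by have := mem_range.1 hk; omega
  rw [hkj, pow_add (1 + Real.exp (-x)) (j - k) (m + k)]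
  field_simp

private lemma integral_exp_neg_div_one_add_exp_neg_pow_sub {h j k : ℕ}
    (hjk : 2 ≤ h - 2 * j + k) (hj : 2 * j ≤ h) :
    ∫ x in Set.Ioi (0 : ℝ), Real.exp (-x) / (1 + Real.exp (-x)) ^ (h - 2 * j + k) =
      1 / ((h : ℝ) - 2 * j + k - 1) * (1 - 1 / 2 ^ (h - 2 * j + k - 1)) := by
  obtain ⟨n, hn⟩ := Nat.exists_eq_add_of_le' hjk
  have hcast : (h : ℝ) - 2 * j + k = n + 2 := by
    have := congrArg (Nat.cast (R := ℝ)) hn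
    push_cast [Nat.cast_sub hj] at this
    exact this
  rw [hn, hcast, integral_exp_neg_div_one_add_exp_neg_pow]
  congr 2
  ring

private lemma IB_eq_sum_of_two_le {h j : ℕ} (hj : 2 * j + 2 ≤ h) :
    IB (j + 1) (h - j) = ∑ k ∈ range (j + 1), (Nat.choose j k : ℝ) *
      ((-1) ^ k / ((h : ℝ) - 2 * j + k - 1)) * (1 - 1 / 2 ^ (h - 2 * j + k - 1)) := by
  rw [show h - j = j + (h - 2 * j) by omega, IB_eq_sum]
  refine sum_congr rfl fun k _ => ?_
  rw [integral_exp_neg_div_one_add_exp_neg_pow_sub (by omega) (by omega)]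
  ring

private lemma sum_range_succ_eq_add_sum_Icc (f : ℕ → ℝ) (j : ℕ) :
    ∑ k ∈ range (j + 1), f k = f 0 + ∑ k ∈ Icc 1 j, f k := by
  rw [range_eq_Ico, sum_eq_sum_Ico_succ_bot j.succ_pos]
  rfl

/-- Formula for `β_h` by parity: if `h` is even then
`β_h = Σ_{j=0}^{(h−2)/2} C(h−j−1,j) Σ_{k=0}^{j} C(j,k) ((−1)^k/(h−2j+k−1))(1 − 1/2^{h−2j+k−1})`,
and if `h` is odd then
`β_h = log 2 + Σ_{j=0}^{(h−1)/2} C(h−j−1,j) Σ_{k=1}^{j} C(j,k) ((−1)^k/(h−2j+k−1))(1 − 1/2^{h−2j+k−1})`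
`+ Σ_{j=0}^{(h−3)/2} C(h−j−1,j) (1/(h−2j−1))(1 − 1/2^{h−2j−1})`. -/
theorem betaC_formula (h : ℕ) (hh : 1 ≤ h) :
    (Even h → betaC h =
      ∑ j ∈ Finset.range (h / 2), (Nat.choose (h - j - 1) j : ℝ) *
        ∑ k ∈ Finset.range (j + 1), (Nat.choose j k : ℝ) *
          ((-1) ^ k / ((h : ℝ) - 2 * j + k - 1)) *
            (1 - 1 / 2 ^ (h - 2 * j + k - 1))) ∧
    (Odd h → betaC h = Real.log 2 +
      (∑ j ∈ Finset.range ((h + 1) / 2), (Nat.choose (h - j - 1) j : ℝ) *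
        ∑ k ∈ Finset.Icc 1 j, (Nat.choose j k : ℝ) *
          ((-1) ^ k / ((h : ℝ) - 2 * j + k - 1)) *
            (1 - 1 / 2 ^ (h - 2 * j + k - 1))) +
      ∑ j ∈ Finset.range ((h - 1) / 2), (Nat.choose (h - j - 1) j : ℝ) *
        (1 / ((h : ℝ) - 2 * j - 1)) * (1 - 1 / 2 ^ (h - 2 * j - 1))) := by
  refine ⟨fun he => ?_, fun ho => ?_⟩
  · obtain ⟨m, rfl⟩ := he
    rw [betaC, show (m + m + 1) / 2 = (m + m) / 2 by omega]
    refine sum_congr rfl fun j hj => ?_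
    rw [IB_eq_sum_of_two_le (by have := mem_range.1 hj; omega)]
  · obtain ⟨m, rfl⟩ := ho
    rw [betaC, show (2 * m + 1 + 1) / 2 = m + 1 by omega,
      show (2 * m + 1 - 1) / 2 = m by omega, sum_range_succ, sum_range_succ]
    have hlast : IB (m + 1) (2 * m + 1 - m) = Real.log 2 + ∑ k ∈ Icc 1 m, (Nat.choose m k : ℝ) *
        ((-1) ^ k / (((2 * m + 1 : ℕ) : ℝ) - 2 * m + k - 1)) *
          (1 - 1 / 2 ^ (2 * m + 1 - 2 * m + k - 1)) := by
      rw [show 2 * m + 1 - m = m + (2 * m + 1 - 2 * m) by omega, IB_eq_sum,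
        sum_range_succ_eq_add_sum_Icc]
      congr 1
      · simp only [Nat.add_sub_cancel_left, add_zero, integral_exp_neg_div_one_add_exp_neg]
        simp
      · refine sum_congr rfl fun k hk => ?_
        rw [integral_exp_neg_div_one_add_exp_neg_pow_sub
          (by have := mem_Icc.1 hk; omega) (by omega)]
        ring
    have hfirst : ∀ j ∈ range m, (Nat.choose (2 * m + 1 - j - 1) j : ℝ) *
        IB (j + 1) (2 * m + 1 - j) =
        (Nat.choose (2 * m + 1 - j - 1) j : ℝ) * (∑ k ∈ Icc 1 j, (Nat.choose j k : ℝ) *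
          ((-1) ^ k / (((2 * m + 1 : ℕ) : ℝ) - 2 * j + k - 1)) *
            (1 - 1 / 2 ^ (2 * m + 1 - 2 * j + k - 1))) +
        (Nat.choose (2 * m + 1 - j - 1) j : ℝ) *
          (1 / (((2 * m + 1 : ℕ) : ℝ) - 2 * j - 1)) *
            (1 - 1 / 2 ^ (2 * m + 1 - 2 * j - 1)) := by
      intro j hj
      rw [IB_eq_sum_of_two_le (by have := mem_range.1 hj; omega), sum_range_succ_eq_add_sum_Icc]
      simp only [Nat.choose_zero_right, Nat.cast_one, pow_zero, Nat.cast_zero, add_zero]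
      ring
    have hchoose : Nat.choose (2 * m + 1 - m - 1) m = 1 := by
      rw [show 2 * m + 1 - m - 1 = m by omega, Nat.choose_self]
    rw [sum_congr rfl hfirst, sum_add_distrib, hlast, hchoose, Nat.cast_one]
    ring
end

section
/- For all integers n ≥ 0 and m ≥ 1 and all real x, the polynomial F_{n,m}(x) := Σ_{k=0}^{n} C(n, k) (−1)^k x^{m+k}/(m+k) satisfies F_{n,m}(x) = x^m · ( Σ_{j=0}^{n+m−1} (1−x)^{n−j} C(n+m−1−j, m−1) ) / ( m · C(n+m, m) ). -/
open Finset

lemma add_mul_sum_choose_div_succ (n p : ℕ) (x : ℝ) :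
    ((n : ℝ) + p + 2) * ∑ k ∈ range (n + 2),
        (Nat.choose (n + 1) k : ℝ) * (-1) ^ k * x ^ k / ((p : ℝ) + 1 + k) =
      ((n : ℝ) + 1) * ∑ k ∈ range (n + 1),
        (Nat.choose n k : ℝ) * (-1) ^ k * x ^ k / ((p : ℝ) + 1 + k) + (1 - x) ^ (n + 1) := by
  have hpow : (1 - x) ^ (n + 1) =
      ∑ k ∈ range (n + 2), (Nat.choose (n + 1) k : ℝ) * (-1) ^ k * x ^ k := by
    rw [show 1 - x = -x + 1 by ring, add_pow]
    refine sum_congr rfl fun k _ => ?_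
    rw [neg_pow]
    ring
  have hext : ∑ k ∈ range (n + 1),
        (Nat.choose n k : ℝ) * (-1) ^ k * x ^ k / ((p : ℝ) + 1 + k) =
      ∑ k ∈ range (n + 2),
        (Nat.choose n k : ℝ) * (-1) ^ k * x ^ k / ((p : ℝ) + 1 + k) := by
    rw [sum_range_succ _ (n + 1)]
    simp
  rw [hext, hpow, mul_sum, mul_sum, ← sum_add_distrib]
  refine sum_congr rfl fun k hk => ?_
  have hk' : k ≤ n + 1 := Nat.lt_succ_iff.mp (mem_range.mp hk)
  have hchoose : ((n : ℝ) + 1) * Nat.choose n k = Nat.choose (n + 1) k * ((n : ℝ) + 1 - k) := by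
    have h := congrArg (Nat.cast : ℕ → ℝ) (Nat.choose_mul_succ_eq n k)
    push_cast [Nat.cast_sub hk'] at h
    linear_combination h
  have hpos : (p : ℝ) + 1 + k ≠ 0 := by positivity
  field_simp
  linear_combination (-x ^ k) * hchoose

lemma mul_choose_mul_sum_choose_div (n p : ℕ) (x : ℝ) :
    ((p : ℝ) + 1) * Nat.choose (n + (p + 1)) (p + 1) * ∑ k ∈ range (n + 1),
        (Nat.choose n k : ℝ) * (-1) ^ k * x ^ k / ((p : ℝ) + 1 + k) =
      ∑ i ∈ range (n + 1), (1 - x) ^ i * (Nat.choose (p + i) p : ℝ) := by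
  induction n with
  | zero =>
    have hpos : (p : ℝ) + 1 ≠ 0 := by positivity
    simp [hpos]
  | succ n ih =>
    rw [sum_range_succ (fun i => (1 - x) ^ i * (Nat.choose (p + i) p : ℝ)), ← ih]
    have hstep := add_mul_sum_choose_div_succ n p x
    have hup : ((p : ℝ) + 1) * Nat.choose (n + 1 + (p + 1)) (p + 1) =
        ((n : ℝ) + p + 2) * Nat.choose (p + (n + 1)) p := by
      have h := congrArg (Nat.cast : ℕ → ℝ) (Nat.add_one_mul_choose_eq (p + (n + 1)) p)
      rw [show n + 1 + (p + 1) = p + (n + 1) + 1 by ring]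
      push_cast at h
      linear_combination -h
    have hdown : ((p : ℝ) + 1) * Nat.choose (n + (p + 1)) (p + 1) =
        ((n : ℝ) + 1) * Nat.choose (p + (n + 1)) p := by
      have h := congrArg (Nat.cast : ℕ → ℝ) (Nat.choose_succ_right_eq (p + (n + 1)) p)
      rw [show n + (p + 1) = p + (n + 1) by ring]
      rw [Nat.add_sub_cancel_left] at h
      push_cast at h
      linear_combination h
    rw [hup, hdown]
    linear_combination (Nat.choose (p + (n + 1)) p : ℝ) * hstep

lemma sum_zpow_mul_choose_eq (n p : ℕ) (y : ℝ) :
    ∑ j ∈ range (n + (p + 1)),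
        y ^ ((n : ℤ) - j) * (Nat.choose (n + (p + 1) - 1 - j) p : ℝ) =
      ∑ i ∈ range (n + 1), y ^ i * (Nat.choose (p + i) p : ℝ) := by
  rw [← sum_range_reflect (fun i => y ^ i * (Nat.choose (p + i) p : ℝ))]
  symm
  refine sum_subset_zero_on_sdiff (range_subset_range.mpr (by omega)) (fun j hj => ?_)
    fun j hj => ?_
  · simp only [mem_sdiff, mem_range] at hj
    rw [Nat.choose_eq_zero_of_lt (by omega)]
    simp
  · have hj' : j ≤ n := Nat.lt_succ_iff.mp (mem_range.mp hj)
    rw [show (n : ℤ) - j = ((n + 1 - 1 - j : ℕ) : ℤ) by omega, zpow_natCast,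
      show n + (p + 1) - 1 - j = p + (n + 1 - 1 - j) by omega]

/-- For `n ≥ 0`, `m ≥ 1` and real `x`,
`F_{n,m}(x) := Σ_{k=0}^{n} C(n,k) (−1)^k x^{m+k}/(m+k)` equals
`x^m (Σ_{j=0}^{n+m−1} (1−x)^{n−j} C(n+m−1−j, m−1)) / (m C(n+m, m))`,
where the (possibly negative) exponent `n − j` is an integer power. -/
theorem F_nm_eval (n m : ℕ) (hm : 1 ≤ m) (x : ℝ) :
    ∑ k ∈ Finset.range (n + 1),
        (Nat.choose n k : ℝ) * (-1) ^ k * x ^ (m + k) / ((m : ℝ) + k) =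
      x ^ m *
        (∑ j ∈ Finset.range (n + m),
          (1 - x) ^ ((n : ℤ) - j) * (Nat.choose (n + m - 1 - j) (m - 1) : ℝ)) /
        ((m : ℝ) * (Nat.choose (n + m) m : ℝ)) := by
  obtain ⟨p, rfl⟩ : ∃ p, m = p + 1 := ⟨m - 1, by omega⟩
  rw [Nat.add_sub_cancel, sum_zpow_mul_choose_eq, ← mul_choose_mul_sum_choose_div]
  have hchoose : (Nat.choose (n + (p + 1)) (p + 1) : ℝ) ≠ 0 := by
    exact_mod_cast (Nat.choose_pos (by omega)).ne'
  have hpos : (p : ℝ) + 1 ≠ 0 := by positivity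
  push_cast
  rw [eq_div_iff (mul_ne_zero hpos hchoose)]
  rw [show ∑ k ∈ range (n + 1),
      (Nat.choose n k : ℝ) * (-1) ^ k * x ^ (p + 1 + k) / ((p : ℝ) + 1 + k) =
      x ^ (p + 1) * ∑ k ∈ range (n + 1),
        (Nat.choose n k : ℝ) * (-1) ^ k * x ^ k / ((p : ℝ) + 1 + k) by
    rw [mul_sum]
    exact sum_congr rfl fun k _ => by rw [pow_add]; ring]
  ring
end

section
/- Let m ≥ 0. If n = 2m, then Σ_{k=0}^{m} (1/(n−2k+1)) C(n−k, k) 2^k = (2^{n+1} − 1)/(n+1). If n = 2m+1, then Σ_{k=0}^{m} (1/(n−2k+1)) C(n−k, k) 2^k = (2^{m+1} − 1)²/(n+1). -/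
open Finset

/-- The Pascal-type recurrence for the truncated sums `∑ C(n - k, k) x ^ k`. -/
theorem sum_choose_sub_mul_pow_succ {R : Type*} [CommSemiring R] (x : R) {n r : ℕ} (h : r ≤ n) :
    ∑ k ∈ Finset.range (r + 2), (Nat.choose (n + 2 - k) k : R) * x ^ k =
      ∑ k ∈ Finset.range (r + 2), (Nat.choose (n + 1 - k) k : R) * x ^ k +
        x * ∑ k ∈ Finset.range (r + 1), (Nat.choose (n - k) k : R) * x ^ k := by
  rw [Finset.sum_range_succ' _ (r + 1), Finset.sum_range_succ' _ (r + 1), Finset.mul_sum,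
    add_right_comm, ← Finset.sum_add_distrib]
  congr 1
  refine Finset.sum_congr rfl fun k hk => ?_
  have hk' := Finset.mem_range.mp hk
  rw [show n + 2 - (k + 1) = (n - k) + 1 by omega, show n + 1 - (k + 1) = n - k by omega,
    Nat.choose_succ_succ]
  push_cast
  ring

/-- Closed forms of `∑ C(n - k, k) 2 ^ k` (the Jacobsthal numbers) for `n` even and odd. -/
theorem sum_choose_sub_mul_two_pow (m : ℕ) :
    ∑ k ∈ Finset.range (m + 1), (Nat.choose (2 * m - k) k : ℚ) * 2 ^ k =
        (2 ^ (2 * m + 1) + 1) / 3 ∧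
      ∑ k ∈ Finset.range (m + 1), (Nat.choose (2 * m + 1 - k) k : ℚ) * 2 ^ k =
        (2 ^ (2 * m + 2) - 1) / 3 := by
  induction m with
  | zero => norm_num
  | succ m ih =>
    obtain ⟨he, ho⟩ := ih
    have he' : ∑ k ∈ Finset.range (m + 2), (Nat.choose (2 * (m + 1) - k) k : ℚ) * 2 ^ k =
        (2 ^ (2 * (m + 1) + 1) + 1) / 3 := by
      rw [show 2 * (m + 1) = 2 * m + 2 by ring,
        sum_choose_sub_mul_pow_succ (2 : ℚ) (show m ≤ 2 * m by omega), he,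
        Finset.sum_range_succ, ho, Nat.choose_eq_zero_of_lt (by omega)]
      push_cast
      ring
    refine ⟨he', ?_⟩
    rw [show 2 * (m + 1) + 1 = (2 * m + 1) + 2 by ring,
      sum_choose_sub_mul_pow_succ (2 : ℚ) (show m ≤ 2 * m + 1 by omega), ho,
      show 2 * m + 1 + 1 = 2 * (m + 1) by ring, he']
    ring

/-- Splitting the weight `(n + 1) / (n - 2k + 1) = 1 + 2k / (n - 2k + 1)`. -/
theorem sum_one_div_mul_choose_sub_mul_pow {K : Type*} [Field K] [CharZero K] (x : K) {n r : ℕ}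
    (h : 2 * r ≤ n) :
    (∑ k ∈ Finset.range (r + 1),
        1 / ((n : K) - 2 * k + 1) * (Nat.choose (n - k) k : K) * x ^ k) * ((n : K) + 1) =
      ∑ k ∈ Finset.range (r + 1), (Nat.choose (n - k) k : K) * x ^ k +
        2 * x * ∑ k ∈ Finset.range r, (Nat.choose (n - 1 - k) k : K) * x ^ k := by
  rw [Finset.sum_range_succ', Finset.sum_range_succ', add_mul, Finset.sum_mul, Finset.mul_sum,
    add_right_comm, ← Finset.sum_add_distrib]
  congr 1
  · refine Finset.sum_congr rfl fun k hk => ?_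
    have hk' := Finset.mem_range.mp hk
    obtain ⟨i, rfl⟩ : ∃ i, n = 2 * k + 2 + i := ⟨n - (2 * k + 2), by omega⟩
    rw [show 2 * k + 2 + i - (k + 1) = k + 1 + i by omega,
      show 2 * k + 2 + i - 1 - k = k + 1 + i by omega]
    have hc := Nat.choose_succ_right_eq (k + 1 + i) k
    rw [show k + 1 + i - k = i + 1 by omega] at hc
    have hc' : (Nat.choose (k + 1 + i) (k + 1) : K) * (k + 1) =
        Nat.choose (k + 1 + i) k * (i + 1) := by exact_mod_cast hc
    have hi : (i : K) + 1 ≠ 0 := Nat.cast_add_one_ne_zero i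
    push_cast
    rw [show (2 * (k : K) + 2 + i) - 2 * (k + 1) + 1 = i + 1 by ring]
    field_simp
    linear_combination 2 * x ^ (k + 1) * hc'
  · have hn : (n : K) + 1 ≠ 0 := Nat.cast_add_one_ne_zero n
    simp [hn]

/-- If `n = 2m` then `Σ_{k=0}^{m} (1/(n−2k+1)) C(n−k,k) 2^k = (2^{n+1} − 1)/(n+1)`,
and if `n = 2m+1` then `Σ_{k=0}^{m} (1/(n−2k+1)) C(n−k,k) 2^k = (2^{m+1} − 1)²/(n+1)`. -/
theorem sum_choose_two_pow (m : ℕ) :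
    (∑ k ∈ Finset.range (m + 1),
        1 / ((2 * m : ℚ) - 2 * k + 1) * (Nat.choose (2 * m - k) k : ℚ) * 2 ^ k =
      (2 ^ (2 * m + 1) - 1) / ((2 * m : ℚ) + 1)) ∧
    (∑ k ∈ Finset.range (m + 1),
        1 / ((2 * m + 1 : ℚ) - 2 * k + 1) * (Nat.choose (2 * m + 1 - k) k : ℚ) * 2 ^ k =
      ((2 ^ (m + 1) - 1) : ℚ) ^ 2 / ((2 * m + 1 : ℚ) + 1)) := by
  obtain ⟨he, ho⟩ := sum_choose_sub_mul_two_pow m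
  constructor
  · rw [eq_div_iff (by positivity)]
    have hs := sum_one_div_mul_choose_sub_mul_pow (2 : ℚ) (le_refl (2 * m))
    push_cast at hs
    rw [hs, he]
    cases m with
    | zero => norm_num
    | succ m =>
      rw [show 2 * (m + 1) - 1 = 2 * m + 1 by omega, (sum_choose_sub_mul_two_pow m).2]
      ring
  · rw [eq_div_iff (by positivity)]
    have hs := sum_one_div_mul_choose_sub_mul_pow (2 : ℚ) (Nat.le_succ (2 * m))
    rw [Finset.sum_range_succ, show 2 * m - m = m by omega, Nat.choose_self] at he
    push_cast at hs he
    rw [hs, ho, eq_sub_of_add_eq he]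
    ring
end

section
/- For every integer h ≥ 1, α_h = ( H_h − H_{⌈(h−1)/2⌉} + H_{h−1} − H_{⌈(h−2)/2⌉} ) / 2, where H_n denotes the n-th harmonic number. -/
open Finset

/-- The harmonic number `H_n = Σ_{k=1}^{n} 1/k` (with `H_0 = 0`). -/
noncomputable def harm (n : ℕ) : ℝ := ∑ k ∈ Finset.range n, 1 / ((k : ℝ) + 1)

open MeasureTheory in
/-- `I_A(j, 2(m+1))` is half of the Beta integral `B(j+1, m+1)`, with an integrable integrand. -/
theorem integrableOn_and_IA_two_mul_succ (j m : ℕ) :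
    IntegrableOn (fun x : ℝ => (1 - Real.exp (-2 * x)) ^ j *
      Real.exp (-((2 * (m + 1) : ℕ) : ℝ) * x)) (Set.Ioi 0) ∧
    IA j (2 * (m + 1)) = (j.factorial * m.factorial : ℝ) / (2 * (j + m + 1).factorial) := by
  induction j generalizing m with
  | zero =>
    have hneg : -((2 * (m + 1) : ℕ) : ℝ) < 0 := by
      push_cast
      linarith [m.cast_nonneg (α := ℝ)]
    refine ⟨by simpa using integrableOn_exp_mul_Ioi hneg 0, ?_⟩
    have hint := integral_exp_mul_Ioi hneg 0
    simp only [IA, pow_zero, one_mul, hint, mul_zero, Real.exp_zero, zero_add,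
      Nat.factorial_zero, Nat.factorial_succ]
    have := m.factorial_ne_zero
    push_cast
    field_simp
  | succ j ih =>
    obtain ⟨hi₁, hv₁⟩ := ih m
    obtain ⟨hi₂, hv₂⟩ := ih (m + 1)
    have hsplit : (fun x : ℝ => (1 - Real.exp (-2 * x)) ^ (j + 1) *
        Real.exp (-((2 * (m + 1) : ℕ) : ℝ) * x)) =
        (fun x : ℝ => (1 - Real.exp (-2 * x)) ^ j *
          Real.exp (-((2 * (m + 1) : ℕ) : ℝ) * x)) -
        (fun x : ℝ => (1 - Real.exp (-2 * x)) ^ j *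
          Real.exp (-((2 * (m + 1 + 1) : ℕ) : ℝ) * x)) := by
      funext x
      have hexp : Real.exp (-((2 * (m + 1 + 1) : ℕ) : ℝ) * x) =
          Real.exp (-2 * x) * Real.exp (-((2 * (m + 1) : ℕ) : ℝ) * x) := by
        rw [← Real.exp_add]
        congr 1
        push_cast
        ring
      rw [Pi.sub_apply, hexp]
      ring
    have hrec : IA (j + 1) (2 * (m + 1)) = IA j (2 * (m + 1)) - IA j (2 * (m + 1 + 1)) := by
      unfold IA
      rw [hsplit, ← integral_sub hi₁ hi₂]
      rfl
    refine ⟨hsplit ▸ hi₁.sub hi₂, ?_⟩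
    rw [hrec, hv₁, hv₂, show j + (m + 1) + 1 = j + m + 1 + 1 by ring,
      show j + 1 + m + 1 = j + m + 1 + 1 by ring, Nat.factorial_succ (j + m + 1),
      Nat.factorial_succ m, Nat.factorial_succ j]
    have := (j + m + 1).factorial_ne_zero
    push_cast
    field_simp
    ring

theorem choose_mul_IA {n j : ℕ} (hj : 2 * j < n) :
    (Nat.choose (n - j - 1) j : ℝ) * IA j (2 * n - 4 * j) = 1 / ((n - j : ℕ) : ℝ) / 2 := by
  obtain ⟨m, rfl⟩ : ∃ m, n = 2 * j + m + 1 := ⟨n - 2 * j - 1, by omega⟩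
  rw [show 2 * j + m + 1 - j - 1 = j + m by omega,
    show 2 * (2 * j + m + 1) - 4 * j = 2 * (m + 1) by omega,
    show 2 * j + m + 1 - j = j + m + 1 by omega,
    (integrableOn_and_IA_two_mul_succ j m).2, Nat.cast_add_choose, Nat.factorial_succ (j + m)]
  have := j.factorial_ne_zero
  have := m.factorial_ne_zero
  have := (j + m).factorial_ne_zero
  push_cast
  field_simp

theorem sum_one_div_sub_eq_harm_sub {n k : ℕ} (hk : k ≤ n) :
    ∑ j ∈ Finset.range k, 1 / ((n - j : ℕ) : ℝ) = harm n - harm (n - k) := by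
  induction k with
  | zero => simp
  | succ k ih =>
    obtain ⟨d, rfl⟩ : ∃ d, n = d + 1 + k := ⟨n - k - 1, by omega⟩
    rw [Finset.sum_range_succ, ih (by omega), show d + 1 + k - k = d + 1 by omega,
      show d + 1 + k - (k + 1) = d by omega]
    simp only [harm, Finset.sum_range_succ _ d]
    push_cast
    ring

theorem sum_choose_mul_IA (n : ℕ) :
    ∑ j ∈ Finset.range ((n + 1) / 2), (Nat.choose (n - j - 1) j : ℝ) * IA j (2 * n - 4 * j) =
      (harm n - harm (n / 2)) / 2 := by
  rw [Finset.sum_congr rfl fun j hj => choose_mul_IA (n := n) (j := j) <| by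
      rw [Finset.mem_range] at hj
      omega,
    ← Finset.sum_div, sum_one_div_sub_eq_harm_sub (by omega), show n - (n + 1) / 2 = n / 2 by omega]

/-- For every `h ≥ 1`, `α_h = (H_h − H_{⌈(h−1)/2⌉} + H_{h−1} − H_{⌈(h−2)/2⌉})/2`.
Note that for `h ≥ 1` one has `⌈(h−1)/2⌉ = h/2` and `⌈(h−2)/2⌉ = (h−1)/2`
as natural number divisions. -/
theorem alphaC_eq_harmonic (h : ℕ) (hh : 1 ≤ h) :
    alphaC h = (harm h - harm (h / 2) + harm (h - 1) - harm ((h - 1) / 2)) / 2 := by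
  obtain ⟨n, rfl⟩ : ∃ n, h = n + 1 := ⟨h - 1, by omega⟩
  have hsecond : ∑ j ∈ Finset.range ((n + 1) / 2),
      (Nat.choose (n + 1 - j - 2) j : ℝ) * IA j (2 * (n + 1) - 4 * j - 2) =
      (harm n - harm (n / 2)) / 2 := by
    rw [← sum_choose_mul_IA n]
    refine Finset.sum_congr rfl fun j _ => ?_
    rw [show n + 1 - j - 2 = n - j - 1 by omega,
      show 2 * (n + 1) - 4 * j - 2 = 2 * n - 4 * j by omega]
  rw [alphaC, sum_choose_mul_IA, hsecond, Nat.add_sub_cancel]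
  ring
end

section
/- Let h ≥ 1 be an integer. If h is even, then β_h = Σ_{c=0}^{(h−2)/2} 1/((2c+1)·2^{2c+1}). If h is odd, then β_h = Σ_{c=0}^{(h−3)/2} 1/((c+1)·2^{c+1}) − Σ_{c=0}^{(h−3)/2} 1/((2c+2)·2^{2c+2}) + ∫_{1/2}^{1} (1−x)^{(h−1)/2} / x dx. -/
open Finset

/-- The weighted Fibonacci recurrence for diagonal sums of Pascal's triangle. -/
theorem sum_antidiagonal_choose_mul_pow_add_two (a b : ℝ) (n : ℕ) :
    ∑ p ∈ antidiagonal (n + 2), (p.1.choose p.2 : ℝ) * a ^ p.2 * b ^ (p.1 - p.2) =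
      b * ∑ p ∈ antidiagonal (n + 1), (p.1.choose p.2 : ℝ) * a ^ p.2 * b ^ (p.1 - p.2) +
      a * ∑ p ∈ antidiagonal n, (p.1.choose p.2 : ℝ) * a ^ p.2 * b ^ (p.1 - p.2) := by
  rw [Nat.antidiagonal_succ_succ', Nat.antidiagonal_succ']
  simp only [sum_cons, sum_map, Function.Embedding.prodMap, Function.Embedding.coeFn_mk,
    Nat.choose_zero_succ, Nat.cast_zero, zero_mul, zero_add, Nat.choose_zero_right, Nat.cast_one, one_mul, pow_zero,
    tsub_zero, mul_add, mul_sum, add_assoc, ← sum_add_distrib]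
  congr 1
  · ring
  refine sum_congr rfl fun p _ => ?_
  obtain ⟨i, j⟩ := p
  change ((i + 1).choose (j + 1) : ℝ) * a ^ (j + 1) * b ^ (i + 1 - (j + 1)) =
    b * ((i.choose (j + 1) : ℝ) * a ^ (j + 1) * b ^ (i - (j + 1))) +
      a * ((i.choose j : ℝ) * a ^ j * b ^ (i - j))
  rw [Nat.choose_succ_succ, Nat.add_sub_add_right]
  rcases Nat.lt_or_ge i (j + 1) with hij | hij
  · simp [Nat.choose_eq_zero_of_lt hij]
    ring
  · obtain ⟨d, rfl⟩ := Nat.exists_eq_add_of_le hij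
    rw [show j + 1 + d - j = d + 1 by omega, show j + 1 + d - (j + 1) = d by omega]
    push_cast
    ring

theorem one_add_mul_sum_antidiagonal_choose (v : ℝ) (n : ℕ) :
    (1 + v) * ∑ p ∈ antidiagonal n, (p.1.choose p.2 : ℝ) * v ^ p.2 * (1 - v) ^ (p.1 - p.2) =
      1 - (-v) ^ (n + 1) := by
  induction n using Nat.twoStepInduction with
  | zero => simp
  | one =>
    simp [Nat.antidiagonal_succ]
    ring
  | more n ih₀ ih₁ =>
    rw [sum_antidiagonal_choose_mul_pow_add_two, mul_add, mul_left_comm, ih₁, mul_left_comm, ih₀]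
    ring

theorem one_add_mul_sum_range_choose (v : ℝ) (h : ℕ) (hh : 1 ≤ h) :
    (1 + v) * ∑ j ∈ range ((h + 1) / 2),
      ((h - j - 1).choose j : ℝ) * (v ^ j * (1 - v) ^ (h - 1 - 2 * j)) = 1 - (-v) ^ h := by
  obtain ⟨n, rfl⟩ := Nat.exists_eq_add_of_le' hh
  rw [← one_add_mul_sum_antidiagonal_choose, ← Nat.sum_antidiagonal_swap,
    Nat.sum_antidiagonal_eq_sum_range_succ_mk]
  congr 1
  have hsub : range ((n + 1 + 1) / 2) ⊆ range n.succ := range_subset_range.2 (by omega)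
  rw [← sum_subset hsub]
  · refine sum_congr rfl fun j _ => ?_
    simp only [Prod.fst_swap, Prod.snd_swap]
    rw [show n + 1 - j - 1 = n - j by omega, show n + 1 - 1 - 2 * j = n - j - j by omega]
    ring
  · intro j _ hj
    rw [mem_range] at hj
    simp [Nat.choose_eq_zero_of_lt (show n - j < j by omega)]

theorem image_exp_neg_div_one_add_exp_neg_Ioi :
    (fun x : ℝ => Real.exp (-x) / (1 + Real.exp (-x))) '' Set.Ioi 0 = Set.Ioo 0 (1 / 2) := by
  ext y
  constructor
  · rintro ⟨x, hx, rfl⟩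
    have h0 := Real.exp_pos (-x)
    have h1 : Real.exp (-x) < 1 := Real.exp_lt_one_iff.2 (neg_lt_zero.2 hx)
    refine ⟨by positivity, ?_⟩
    change _ / _ < _
    rw [div_lt_div_iff₀ (by positivity) (by norm_num)]
    linarith
  · rintro ⟨h0, h1⟩
    have h2 : 0 < 1 - y := by linarith
    refine ⟨-Real.log (y / (1 - y)), ?_, ?_⟩
    · refine neg_pos.2 (Real.log_neg (by positivity) ?_)
      rw [div_lt_one h2]
      linarith
    · simp only [neg_neg]
      rw [Real.exp_log (by positivity)]
      field_simp
      ring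

theorem hasDerivAt_exp_neg_div_one_add_exp_neg (x : ℝ) :
    HasDerivAt (fun x : ℝ => Real.exp (-x) / (1 + Real.exp (-x)))
      (-(Real.exp (-x) / (1 + Real.exp (-x)) ^ 2)) x := by
  have h0 := Real.exp_pos (-x)
  have he : HasDerivAt (fun x : ℝ => Real.exp (-x)) (-Real.exp (-x)) x := by
    simpa using (hasDerivAt_neg x).exp
  refine (he.div (he.const_add 1) (by positivity)).congr_deriv ?_
  field_simp
  ring

theorem injective_exp_neg_div_one_add_exp_neg :
    Function.Injective (fun x : ℝ => Real.exp (-x) / (1 + Real.exp (-x))) := by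
  intro x y hxy
  have hx := Real.exp_pos (-x)
  have hy := Real.exp_pos (-y)
  simp only at hxy
  rw [div_eq_div_iff (by positivity) (by positivity)] at hxy
  exact neg_injective (Real.exp_injective (by linarith))

theorem IB_eq_intervalIntegral (j n : ℕ) :
    IB (j + 1) (n + j + 1) = ∫ v in (0 : ℝ)..(1 / 2), v ^ j * (1 - v) ^ n / (1 - v) := by
  rw [intervalIntegral.integral_of_le (by norm_num), MeasureTheory.integral_Ioc_eq_integral_Ioo,
    ← image_exp_neg_div_one_add_exp_neg_Ioi,
    MeasureTheory.integral_image_eq_integral_abs_deriv_smul measurableSet_Ioi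
      (fun x _ => (hasDerivAt_exp_neg_div_one_add_exp_neg x).hasDerivWithinAt)
      injective_exp_neg_div_one_add_exp_neg.injOn, IB]
  congr 1 with x
  have h0 := Real.exp_pos (-x)
  have h1 : 1 - Real.exp (-x) / (1 + Real.exp (-x)) = 1 / (1 + Real.exp (-x)) := by
    field_simp
    ring
  rw [h1, div_pow, div_pow, one_pow, abs_neg, abs_of_pos (by positivity), smul_eq_mul,
    show -((j + 1 : ℕ) : ℝ) * x = ((j + 1 : ℕ) : ℝ) * -x by ring, Real.exp_nat_mul]
  generalize Real.exp (-x) = t at *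
  field_simp
  ring

theorem one_sub_ne_zero_of_mem_uIcc {v : ℝ} (hv : v ∈ Set.uIcc (0 : ℝ) (1 / 2)) : 1 - v ≠ 0 := by
  rw [Set.uIcc_of_le (by norm_num)] at hv
  linarith [hv.2]

theorem intervalIntegrable_div_one_sub {f : ℝ → ℝ} (hf : Continuous f) :
    IntervalIntegrable (fun v => f v / (1 - v)) MeasureTheory.volume 0 (1 / 2) :=
  (hf.continuousOn.div (by fun_prop) fun _ => one_sub_ne_zero_of_mem_uIcc).intervalIntegrable

theorem betaC_eq_intervalIntegral (h : ℕ) (hh : 1 ≤ h) :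
    betaC h = ∫ v in (0 : ℝ)..(1 / 2), (1 - (-v) ^ h) / (1 - v ^ 2) := by
  have hterm : ∀ j ∈ range ((h + 1) / 2), ((h - j - 1).choose j : ℝ) * IB (j + 1) (h - j) =
      ∫ v in (0 : ℝ)..(1 / 2),
        ((h - j - 1).choose j : ℝ) * (v ^ j * (1 - v) ^ (h - 1 - 2 * j) / (1 - v)) := by
    intro j hj
    rw [mem_range] at hj
    rw [intervalIntegral.integral_const_mul, ← IB_eq_intervalIntegral,
      show h - 1 - 2 * j + j + 1 = h - j by omega]
  rw [betaC, sum_congr rfl hterm, ← intervalIntegral.integral_finsetSum]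
  · refine intervalIntegral.integral_congr fun v hv => ?_
    have h1 := one_sub_ne_zero_of_mem_uIcc hv
    rw [Set.uIcc_of_le (by norm_num)] at hv
    have h2 : 1 + v ≠ 0 := by linarith [hv.1]
    rw [← one_add_mul_sum_range_choose v h hh, show 1 - v ^ 2 = (1 + v) * (1 - v) by ring,
      mul_div_mul_left _ _ h2, sum_div]
    exact sum_congr rfl fun j _ => (mul_div_assoc _ _ _).symm
  · exact fun j _ => (intervalIntegrable_div_one_sub (by fun_prop)).const_mul _

theorem integral_sum_pow_zero_half (m : ℕ) (e : ℕ → ℕ) :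
    ∫ v in (0 : ℝ)..(1 / 2), ∑ c ∈ range m, v ^ e c =
      ∑ c ∈ range m, 1 / (((e c : ℝ) + 1) * 2 ^ (e c + 1)) := by
  rw [intervalIntegral.integral_finsetSum fun c _ => (continuous_pow _).intervalIntegrable _ _]
  refine sum_congr rfl fun c _ => ?_
  rw [integral_pow]
  simp
  ring

theorem one_sub_sq_mul_sum_pow_two_mul (v : ℝ) (m : ℕ) :
    (1 - v ^ 2) * ∑ c ∈ range m, v ^ (2 * c) = 1 - v ^ (2 * m) := by
  simp only [pow_mul]
  exact mul_neg_geom_sum _ _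

/-- If `h` is even then `β_h = Σ_{c=0}^{(h−2)/2} 1/((2c+1)·2^{2c+1})`, and if `h` is odd then
`β_h = Σ_{c=0}^{(h−3)/2} 1/((c+1)·2^{c+1}) − Σ_{c=0}^{(h−3)/2} 1/((2c+2)·2^{2c+2})`
`+ ∫_{1/2}^{1} (1−x)^{(h−1)/2}/x dx` (the sums over `c` being empty for `h = 1`). -/
theorem betaC_simple_formula (h : ℕ) (hh : 1 ≤ h) :
    (Even h → betaC h =
      ∑ c ∈ Finset.range (h / 2), 1 / (((2 * c  : ℝ) + 1) * 2 ^ (2 * c + 1))) ∧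
    (Odd h → betaC h =
      (∑ c ∈ Finset.range ((h - 1) / 2), 1 / (((c : ℝ) + 1) * 2 ^ (c + 1))) -
      (∑ c ∈ Finset.range ((h - 1) / 2), 1 / (((2 * c : ℝ) + 2) * 2 ^ (2 * c + 2))) +
      ∫ x in (1 / 2 : ℝ)..1, (1 - x) ^ ((h - 1) / 2) / x) := by
  rw [betaC_eq_intervalIntegral h hh]
  have hne : ∀ v ∈ Set.uIcc (0 : ℝ) (1 / 2), 1 - v ^ 2 ≠ 0 := by
    intro v hv
    rw [Set.uIcc_of_le (by norm_num)] at hv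
    nlinarith [hv.1, hv.2]
  constructor
  · intro he
    obtain ⟨m, rfl⟩ := he.two_dvd
    have hsum := integral_sum_pow_zero_half m (2 * ·)
    push_cast at hsum
    rw [Nat.mul_div_cancel_left m two_pos, ← hsum]
    refine intervalIntegral.integral_congr fun v hv => ?_
    rw [div_eq_iff (hne v hv), mul_comm _ (1 - v ^ 2), one_sub_sq_mul_sum_pow_two_mul, (even_two_mul m).neg_pow]
  · rintro ⟨m, rfl⟩
    have hsum₁ := integral_sum_pow_zero_half m (·)
    have hsum₂ := integral_sum_pow_zero_half m (2 * · + 1)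
    push_cast at hsum₁ hsum₂
    simp only [add_assoc, one_add_one_eq_two] at hsum₂
    have hsubst : ∫ x in (1 / 2 : ℝ)..1, (1 - x) ^ m / x =
        ∫ v in (0 : ℝ)..(1 / 2), v ^ m / (1 - v) := by
      have := intervalIntegral.integral_comp_sub_left (a := 0) (b := 1 / 2)
        (fun x : ℝ => (1 - x) ^ m / x) 1
      norm_num at this ⊢
      exact this.symm
    rw [show (2 * m + 1 - 1) / 2 = m by omega, hsubst, ← hsum₁, ← hsum₂,
      ← intervalIntegral.integral_sub (Continuous.intervalIntegrable (by fun_prop) _ _)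
        (Continuous.intervalIntegrable (by fun_prop) _ _),
      ← intervalIntegral.integral_add (Continuous.intervalIntegrable (by fun_prop) _ _)
        (intervalIntegrable_div_one_sub (continuous_pow m))]
    refine intervalIntegral.integral_congr fun v hv => ?_
    have h1 := one_sub_ne_zero_of_mem_uIcc hv
    have hgeom : ∑ c ∈ range m, v ^ c = (1 - v ^ m) / (1 - v) := by
      rw [eq_div_iff h1, geom_sum_mul_neg]
    have hodd : ∑ c ∈ range m, v ^ (2 * c + 1) = v * (1 - v ^ (2 * m)) / (1 - v ^ 2) := by
      rw [eq_div_iff (hne v hv), ← one_sub_sq_mul_sum_pow_two_mul]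
      simp only [pow_succ v (2 * _), ← sum_mul]
      ring
    have h2 : 1 + v ≠ 0 := fun h0 => hne v hv (by linear_combination (1 - v) * h0)
    rw [hgeom, hodd, (odd_two_mul_add_one m).neg_pow,
      show 1 - v ^ 2 = (1 + v) * (1 - v) by ring]
    field_simp
    ring
end

section
/- α_h → log 2 as h → ∞. -/
open Finset

open MeasureTheory Filter Topology in
theorem integrableOn_IA (j : ℕ) {l : ℕ} (hl : 0 < l) :
    IntegrableOn (fun x : ℝ => (1 - Real.exp (-2 * x)) ^ j * Real.exp (-(l : ℝ) * x))
      (Set.Ioi 0) := by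
  have hl' : (0 : ℝ) < l := by exact_mod_cast hl
  refine Integrable.mono' (exp_neg_integrableOn_Ioi 0 hl')
    (Continuous.aestronglyMeasurable (by fun_prop)) ?_
  refine (ae_restrict_iff' measurableSet_Ioi).2 (ae_of_all _ fun x hx => ?_)
  have hx : (0 : ℝ) < x := hx
  have h1 : Real.exp (-2 * x) ≤ 1 := Real.exp_le_one_iff.2 (by linarith)
  have h2 := Real.exp_pos (-2 * x)
  rw [Real.norm_of_nonneg (by have := sub_nonneg.2 h1; positivity)]
  exact mul_le_of_le_one_left (Real.exp_pos _).le (pow_le_one₀ (by linarith) (by linarith))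

/-- The bivariate Fibonacci polynomial `Σ_j C(n-j, j) v^j u^(n-2j)`. -/
def fibPoly (u v : ℝ) (n : ℕ) : ℝ :=
  ∑ p ∈ Finset.HasAntidiagonal.antidiagonal n, (Nat.choose p.1 p.2 : ℝ) * (v ^ p.2 * u ^ (p.1 - p.2))

theorem fibPoly_add_two (u v : ℝ) (n : ℕ) :
    fibPoly u v (n + 2) = u * fibPoly u v (n + 1) + v * fibPoly u v n := by
  have key (a b : ℕ) : (Nat.choose (a + 1) (b + 1) : ℝ) * (v ^ (b + 1) * u ^ (a - b)) =
      u * ((Nat.choose a (b + 1) : ℝ) * (v ^ (b + 1) * u ^ (a - (b + 1)))) +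
      v * ((Nat.choose a b : ℝ) * (v ^ b * u ^ (a - b))) := by
    rcases Nat.lt_or_ge b a with hab | hab
    · obtain ⟨c, rfl⟩ := Nat.exists_eq_add_of_lt hab
      rw [Nat.choose_succ_succ, show b + c + 1 - b = c + 1 by omega,
        show b + c + 1 - (b + 1) = c by omega]
      push_cast
      ring
    · rw [Nat.choose_succ_succ, Nat.choose_eq_zero_of_lt (show a < b + 1 by omega)]
      push_cast
      ring
  unfold fibPoly
  rw [Finset.Nat.antidiagonal_succ_succ', Finset.Nat.antidiagonal_succ']
  simp [key, Finset.sum_add_distrib, Finset.mul_sum, mul_add]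
  ring

theorem fibPoly_one_sub (u : ℝ) (n : ℕ) :
    (2 - u) * fibPoly u (1 - u) n = 1 - (u - 1) ^ (n + 1) := by
  induction n using Nat.twoStepInduction with
  | zero => simp [fibPoly]; ring
  | one => simp [fibPoly, Finset.Nat.antidiagonal_succ]; ring
  | more n h1 h2 =>
    rw [fibPoly_add_two]
    linear_combination u * h2 + (1 - u) * h1

theorem sum_range_eq_fibPoly (u v : ℝ) {n m : ℕ} (hm : m = n / 2 + 1) :
    ∑ j ∈ Finset.range m, (Nat.choose (n - j) j : ℝ) * (v ^ j * u ^ (n - 2 * j)) =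
      fibPoly u v n := by
  unfold fibPoly
  rw [← Finset.Nat.sum_antidiagonal_swap]
  simp only [Prod.fst_swap, Prod.snd_swap]
  rw [Finset.Nat.sum_antidiagonal_eq_sum_range_succ
    (fun i j => (Nat.choose j i : ℝ) * (v ^ i * u ^ (j - i)))]
  refine (Finset.sum_congr rfl fun j _ => ?_).trans
    (Finset.sum_subset (Finset.range_subset_range.2 (by omega)) fun j _ hj => ?_)
  · rw [show n - 2 * j = n - j - j by omega]
  · rw [Finset.mem_range] at hj
    rw [Nat.choose_eq_zero_of_lt (by omega)]
    simp

theorem choose_mul_IA_integrand {n j l : ℕ} (hl : l = 2 * (n - 2 * j + 1)) (c x : ℝ) :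
    c * ((1 - Real.exp (-2 * x)) ^ j * Real.exp (-(l : ℝ) * x)) = Real.exp (-2 * x) *
      (c * ((1 - Real.exp (-2 * x)) ^ j * Real.exp (-2 * x) ^ (n - 2 * j))) := by
  have : Real.exp (-(l : ℝ) * x) = Real.exp (-2 * x) * Real.exp (-2 * x) ^ (n - 2 * j) := by
    rw [← pow_succ', ← Real.exp_nat_mul, hl]
    push_cast
    ring_nf
  rw [this]
  ring

open MeasureTheory in
theorem integrableOn_and_sum_choose_mul_IA {n m : ℕ} (hm : m = n / 2 + 1) {a l : ℕ → ℕ}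
    (ha : ∀ j, a j = n - j) (hl : ∀ j < m, l j = 2 * (n - 2 * j + 1)) :
    IntegrableOn (fun x : ℝ => Real.exp (-2 * x) *
      fibPoly (Real.exp (-2 * x)) (1 - Real.exp (-2 * x)) n) (Set.Ioi 0) ∧
    ∑ j ∈ Finset.range m, (Nat.choose (a j) j : ℝ) * IA j (l j) =
      ∫ x in Set.Ioi (0 : ℝ), Real.exp (-2 * x) *
        fibPoly (Real.exp (-2 * x)) (1 - Real.exp (-2 * x)) n := by
  have hfun : (fun x : ℝ => Real.exp (-2 * x) *
      fibPoly (Real.exp (-2 * x)) (1 - Real.exp (-2 * x)) n) =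
      fun x => ∑ j ∈ Finset.range m, (Nat.choose (a j) j : ℝ) *
        ((1 - Real.exp (-2 * x)) ^ j * Real.exp (-(l j : ℝ) * x)) := by
    funext x
    rw [← sum_range_eq_fibPoly _ _ hm, Finset.mul_sum]
    refine Finset.sum_congr rfl fun j hj => ?_
    rw [choose_mul_IA_integrand (hl j (Finset.mem_range.1 hj)), ha]
  have hint (j : ℕ) (hj : j ∈ Finset.range m) :
      Integrable (fun x : ℝ => (Nat.choose (a j) j : ℝ) *
        ((1 - Real.exp (-2 * x)) ^ j * Real.exp (-(l j : ℝ) * x)))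
        (volume.restrict (Set.Ioi 0)) :=
    (integrableOn_IA j (by rw [hl j (Finset.mem_range.1 hj)]; omega)).const_mul _
  rw [hfun]
  refine ⟨integrable_finsetSum _ hint, ?_⟩
  rw [integral_finsetSum _ hint]
  simp only [integral_const_mul, IA]

open MeasureTheory in
theorem alphaC_add_two (n : ℕ) :
    alphaC (n + 2) = ∫ x in Set.Ioi (0 : ℝ), Real.exp (-2 * x) *
      (2 - Real.exp (-2 * x) * (Real.exp (-2 * x) - 1) ^ (n + 1)) / (2 - Real.exp (-2 * x)) := by
  obtain ⟨i1, e1⟩ := integrableOn_and_sum_choose_mul_IA (n := n + 1) (m := (n + 2 + 1) / 2)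
    (a := fun j => n + 2 - j - 1) (l := fun j => 2 * (n + 2) - 4 * j)
    (by omega) (fun j => by omega) (fun j hj => by omega)
  obtain ⟨i2, e2⟩ := integrableOn_and_sum_choose_mul_IA (n := n) (m := (n + 2) / 2)
    (a := fun j => n + 2 - j - 2) (l := fun j => 2 * (n + 2) - 4 * j - 2)
    (by omega) (fun j => by omega) (fun j hj => by omega)
  rw [alphaC, e1, e2, ← integral_add i1 i2]
  refine setIntegral_congr_fun measurableSet_Ioi fun x hx => ?_
  have hx : (0 : ℝ) < x := hx
  have h1 : Real.exp (-2 * x) < 1 := Real.exp_lt_one_iff.mpr (by linarith)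
  generalize Real.exp (-2 * x) = u at h1 ⊢
  rw [eq_div_iff (by linarith)]
  linear_combination u * fibPoly_one_sub u (n + 1) + u * fibPoly_one_sub u n

open MeasureTheory Filter Topology in
theorem integral_two_mul_exp_div :
    ∫ x in Set.Ioi (0 : ℝ), Real.exp (-2 * x) * 2 / (2 - Real.exp (-2 * x)) = Real.log 2 := by
  have hlt {x : ℝ} (hx : 0 ≤ x) : Real.exp (-2 * x) ≤ 1 := Real.exp_le_one_iff.2 (by linarith)
  have hlim : Tendsto (fun x : ℝ => Real.log (2 - Real.exp (-2 * x))) atTop (𝓝 (Real.log 2)) := by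
    have h0 : Tendsto (fun x : ℝ => Real.exp (-2 * x)) atTop (𝓝 0) :=
      Real.tendsto_exp_atBot.comp (tendsto_id.const_mul_atTop_of_neg (by norm_num))
    have := (h0.const_sub 2).log (by norm_num)
    simpa using this
  rw [integral_Ioi_of_hasDerivAt_of_nonneg' (g := fun x => Real.log (2 - Real.exp (-2 * x)))
    (l := Real.log 2) (fun x hx => ?_) (fun x hx => ?_) hlim]
  · norm_num
  · have hx' := hlt (Set.mem_Ici.1 hx)
    have hd : HasDerivAt (fun x : ℝ => 2 - Real.exp (-2 * x)) (Real.exp (-2 * x) * 2) x := by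
      have := (((hasDerivAt_id x).const_mul (-2)).exp).const_sub 2
      simpa using this
    exact hd.log (by linarith)
  · have hx' := hlt (Set.mem_Ioi.1 hx).le
    have := Real.exp_pos (-2 * x)
    exact div_nonneg (by positivity) (by linarith)

/-- `α_h → log 2` as `h → ∞`. -/
theorem alphaC_tendsto_log_two :
    Filter.Tendsto alphaC Filter.atTop (nhds (Real.log 2)) := by
  rw [← Filter.tendsto_add_atTop_iff_nat 2]
  simp only [alphaC_add_two]
  rw [← integral_two_mul_exp_div]
  refine MeasureTheory.tendsto_integral_of_dominated_convergence (fun x => 3 * Real.exp (-2 * x))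
    (fun n => Measurable.aestronglyMeasurable (by fun_prop))
    ((exp_neg_integrableOn_Ioi 0 (by norm_num : (0 : ℝ) < 2)).const_mul 3) (fun n => ?_) ?_
  all_goals
    refine (MeasureTheory.ae_restrict_iff' measurableSet_Ioi).2
      (MeasureTheory.ae_of_all _ fun x hx => ?_)
    have hx : (0 : ℝ) < x := hx
    have h1 : Real.exp (-2 * x) < 1 := Real.exp_lt_one_iff.mpr (by linarith)
    have h0 := Real.exp_pos (-2 * x)
    generalize Real.exp (-2 * x) = u at h0 h1 ⊢
    have habs : |u - 1| < 1 := by rw [abs_lt]; constructor <;> linarith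
  · have hp : |u * (u - 1) ^ (n + 1)| ≤ 1 := by
      rw [abs_mul, abs_pow, abs_of_pos h0]
      exact mul_le_one₀ h1.le (by positivity) (pow_le_one₀ (abs_nonneg _) habs.le)
    rw [Real.norm_eq_abs, abs_div, abs_mul, abs_of_pos h0, abs_of_pos (by linarith : 0 < 2 - u),
      div_le_iff₀ (by linarith)]
    have h3 : |2 - u * (u - 1) ^ (n + 1)| ≤ 3 := by
      rw [abs_le] at hp ⊢
      constructor <;> linarith [hp.1, hp.2]
    nlinarith [mul_le_mul_of_nonneg_left h3 h0.le, mul_pos h0 (sub_pos.2 h1)]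
  · have hpow : Filter.Tendsto (fun n : ℕ => (u - 1) ^ (n + 1)) Filter.atTop (nhds 0) :=
      (tendsto_pow_atTop_nhds_zero_of_abs_lt_one habs).comp (Filter.tendsto_add_atTop_nat 1)
    simpa using (((hpow.const_mul u).const_sub 2).const_mul u).div_const (2 - u)
end

section
/- β_h → (log 3)/2 as h → ∞. -/
open Finset

/-- The bivariate Fibonacci sum at a product `t (1 + t)`, in Binet form. -/
theorem sum_antidiagonal_choose_mul_pow (t : ℝ) (n : ℕ) :
    (1 + 2 * t) * ∑ p ∈ antidiagonal n, (Nat.choose p.2 p.1 : ℝ) * (t * (1 + t)) ^ p.1 =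
      (1 + t) ^ (n + 1) - (-t) ^ (n + 1) := by
  induction n using Nat.twoStepInduction with
  | zero => simp; ring
  | one => simp [Finset.Nat.antidiagonal_succ]; ring
  | more n h1 h2 =>
    have key : ∑ p ∈ antidiagonal (n + 2), (Nat.choose p.2 p.1 : ℝ) * (t * (1 + t)) ^ p.1 =
        (t * (1 + t)) *
            ∑ p ∈ antidiagonal n, (Nat.choose p.2 p.1 : ℝ) * (t * (1 + t)) ^ p.1 +
          ∑ p ∈ antidiagonal (n + 1), (Nat.choose p.2 p.1 : ℝ) * (t * (1 + t)) ^ p.1 := by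
      rw [Finset.Nat.antidiagonal_succ_succ']
      simp only [Finset.sum_cons, Finset.sum_map, Finset.Nat.antidiagonal_succ (n := n),
        Finset.mul_sum]
      simp [Nat.choose_succ_succ, add_mul, Finset.sum_add_distrib, pow_succ]
      have : ∀ p : ℕ × ℕ, (p.2.choose p.1 : ℝ) * ((t * (1 + t)) ^ p.1 * (t * (1 + t))) =
          t * (1 + t) * ((p.2.choose p.1 : ℝ) * (t * (1 + t)) ^ p.1) := fun p => by ring
      simp only [this]
      ring
    rw [key, mul_add, h2, mul_left_comm, h1]
    ring

theorem sum_range_choose_mul_pow_div {t : ℝ} (ht : 0 < t) (h : ℕ) :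
    ∑ j ∈ range ((h + 1) / 2),
        (Nat.choose (h - j - 1) j : ℝ) * (t ^ (j + 1) / (1 + t) ^ (h - j)) =
      t / (1 + 2 * t) * (1 - (-(t / (1 + t))) ^ h) := by
  obtain _ | n := h
  · simp
  have hB := sum_antidiagonal_choose_mul_pow t n
  rw [Finset.Nat.sum_antidiagonal_eq_sum_range_succ
    (fun i j => (Nat.choose j i : ℝ) * (t * (1 + t)) ^ i)] at hB
  have hsub : range ((n + 1 + 1) / 2) ⊆ range n.succ := range_subset_range.2 (by omega)
  have h1 : (1 + t) ≠ 0 := by positivity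
  have h2 : (1 + 2 * t) ≠ 0 := by positivity
  have hterm : ∀ j ∈ range ((n + 1 + 1) / 2),
      (Nat.choose (n + 1 - j - 1) j : ℝ) * (t ^ (j + 1) / (1 + t) ^ (n + 1 - j)) =
        t / (1 + t) ^ (n + 1) * ((Nat.choose (n - j) j : ℝ) * (t * (1 + t)) ^ j) := by
    intro j hj
    rw [mem_range] at hj
    have e : (1 + t) ^ (n + 1) = (1 + t) ^ (n + 1 - j) * (1 + t) ^ j := by
      rw [← pow_add]; congr 1; omega
    rw [e, show n + 1 - j - 1 = n - j by omega, mul_pow, pow_succ]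
    field_simp
  rw [sum_congr rfl hterm, ← mul_sum, sum_subset hsub]
  · rw [← mul_right_inj' h2, mul_left_comm, hB, neg_div', div_pow]
    field_simp
  · intro j _ hj
    rw [mem_range] at hj
    rw [Nat.choose_eq_zero_of_lt (by omega)]
    simp

theorem integrableOn_exp_neg_div_one_add_pow (j k : ℕ) :
    MeasureTheory.IntegrableOn
      (fun x : ℝ => Real.exp (-((j + 1 : ℕ) : ℝ) * x) / (1 + Real.exp (-x)) ^ k)
      (Set.Ioi 0) := by
  have hpos : ∀ x : ℝ, (1 + Real.exp (-x)) ^ k ≠ 0 := fun x => by positivity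
  have hneg : -((j + 1 : ℕ) : ℝ) < 0 := neg_lt_zero.2 (Nat.cast_pos.2 j.succ_pos)
  refine (integrableOn_exp_mul_Ioi hneg 0).mono'
    (Continuous.aestronglyMeasurable (by fun_prop (disch := exact hpos _))) ?_
  refine Filter.Eventually.of_forall fun x => ?_
  rw [Real.norm_of_nonneg (by positivity)]
  exact div_le_self (Real.exp_pos _).le (one_le_pow₀ (by linarith [Real.exp_pos (-x)]))

theorem betaC_eq_integral (h : ℕ) :
    betaC h = ∫ x in Set.Ioi (0 : ℝ), Real.exp (-x) / (1 + 2 * Real.exp (-x)) *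
      (1 - (-(Real.exp (-x) / (1 + Real.exp (-x)))) ^ h) := by
  simp only [betaC, IB, ← MeasureTheory.integral_const_mul]
  rw [← MeasureTheory.integral_finsetSum _ fun j _ =>
    (integrableOn_exp_neg_div_one_add_pow j (h - j)).const_mul _]
  refine MeasureTheory.integral_congr_ae (Filter.Eventually.of_forall fun x => ?_)
  simp only
  rw [← sum_range_choose_mul_pow_div (Real.exp_pos (-x))]
  refine sum_congr rfl fun j _ => ?_
  rw [← Real.exp_nat_mul, neg_mul_comm]

theorem integral_exp_neg_div_one_add_two_mul :
    ∫ x in Set.Ioi (0 : ℝ), Real.exp (-x) / (1 + 2 * Real.exp (-x)) = Real.log 3 / 2 := by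
  have hd : ∀ x : ℝ, HasDerivAt (fun x => -(Real.log (1 + 2 * Real.exp (-x)) / 2))
      (Real.exp (-x) / (1 + 2 * Real.exp (-x))) x := by
    intro x
    have hp : (1 + 2 * Real.exp (-x)) ≠ 0 := by positivity
    convert! ((((((hasDerivAt_id x).neg.exp).const_mul 2).const_add 1).log hp).div_const 2).neg
      using 1
    simp
    field_simp
  have ht : Filter.Tendsto (fun x : ℝ => -(Real.log (1 + 2 * Real.exp (-x)) / 2)) Filter.atTop
      (nhds 0) := by
    have h1 : Filter.Tendsto (fun x : ℝ => 1 + 2 * Real.exp (-x)) Filter.atTop (nhds 1) := by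
      simpa using (Real.tendsto_exp_neg_atTop_nhds_zero.const_mul 2).const_add 1
    simpa using ((h1.log one_ne_zero).div_const 2).neg
  rw [MeasureTheory.integral_Ioi_of_hasDerivAt_of_nonneg' (fun x _ => hd x)
    (fun x _ => by positivity) ht]
  norm_num

/-- `β_h → (log 3)/2` as `h → ∞`. -/
theorem betaC_tendsto_half_log_three :
    Filter.Tendsto betaC Filter.atTop (nhds (Real.log 3 / 2)) := by
  rw [funext betaC_eq_integral, ← integral_exp_neg_div_one_add_two_mul]
  refine MeasureTheory.tendsto_integral_of_dominated_convergence
    (fun x => 2 * Real.exp (-1 * x)) (fun h => ?_)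
    ((integrableOn_exp_mul_Ioi (by norm_num) 0).const_mul 2) (fun h => ?_) ?_
  · have h1 : ∀ x : ℝ, 1 + Real.exp (-x) ≠ 0 := fun x => by positivity
    have h2 : ∀ x : ℝ, 1 + 2 * Real.exp (-x) ≠ 0 := fun x => by positivity
    refine Continuous.aestronglyMeasurable ?_
    fun_prop (disch := first | exact h1 _ | exact h2 _)
  · refine Filter.Eventually.of_forall fun x => ?_
    have hq : |-(Real.exp (-x) / (1 + Real.exp (-x)))| ≤ 1 := by
      rw [abs_neg, abs_of_nonneg (by positivity)]
      exact div_le_one_of_le₀ (by linarith) (by positivity)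
    rw [Real.norm_eq_abs, abs_mul, abs_of_nonneg (by positivity), mul_comm, neg_one_mul]
    refine mul_le_mul ?_ (div_le_self (Real.exp_pos _).le (by linarith [Real.exp_pos (-x)]))
      (by positivity) zero_le_two
    refine (abs_sub _ _).trans ?_
    rw [abs_one, abs_pow]
    linarith [pow_le_one₀ (n := h) (abs_nonneg _) hq]
  · refine Filter.Eventually.of_forall fun x => ?_
    have hq : |-(Real.exp (-x) / (1 + Real.exp (-x)))| < 1 := by
      rw [abs_neg, abs_of_nonneg (by positivity), div_lt_one (by positivity)]
      linarith
    simpa using ((tendsto_pow_atTop_nhds_zero_of_abs_lt_one hq).const_sub 1).const_mul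
      (Real.exp (-x) / (1 + 2 * Real.exp (-x)))
end
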